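/- arXiv:1601.01433 — 6 statements merged into one kernel-verified Lean document; each statement's English description precedes it below -/
import Mathlib

section
/- Let p be an odd prime and let Q be a quadratic form on the vector space (F_p)^3 whose associated symmetric bilinear form B(x,y) = (Q(x+y) - Q(x) - Q(y))/2 has Gram matrix with determinant d ≠ 0. Then the number of points [x] of the projective plane P^2(F_p) with Q(x) = 0 equals p + 1, and for each ε ∈ {1, -1} the number of points [x] of P^2(F_p) with χ(Q(x)) = ε equals p(p + ε·χ(-d))/2, where χ denotes the quadratic (Legendre) character of F_p (note that χ(Q(x)) is well defined on projective points since Q(tx) = t²Q(x)). -/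
theorem sum_fin_three {F : Type*} [Fintype F] (g : (Fin 3 → F) → ℤ) :
    ∑ v, g v = ∑ y, ∑ z, ∑ x, g ![x, y, z] := by
  let e : (Fin 3 → F) ≃ F × F × F :=
    ⟨fun v => (v 1, v 2, v 0), fun t => ![t.2.2, t.1, t.2.1],
      fun v => by ext i; fin_cases i <;> rfl, fun _ => rfl⟩
  rw [← Equiv.sum_comp e.symm, Fintype.sum_prod_type]
  simp_rw [Fintype.sum_prod_type]
  rfl

section SumsOverFiniteField

variable {F : Type*} [Field F] [Fintype F] [DecidableEq F]

theorem sum_comp_sq_eq_sum_quadraticChar (hF : ringChar F ≠ 2) (g : F → ℤ) :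
    ∑ x, g (x ^ 2) = ∑ s, (1 + quadraticChar F s) * g s := by
  rw [← Finset.sum_fiberwise (g := fun x : F => x ^ 2)]
  refine Finset.sum_congr rfl fun s _ => ?_
  rw [Finset.sum_congr rfl (g := fun _ => g s) fun x hx => by rw [(Finset.mem_filter.1 hx).2],
    Finset.sum_const, nsmul_eq_mul, add_comm 1, ← quadraticChar_card_sqrts hF s]
  congr 3
  ext x
  simp

theorem sum_quadraticChar_add_mul (hF : ringChar F ≠ 2) (a t : F) :
    ∑ s, quadraticChar F (a + t * s) =
      if t = 0 then Fintype.card F * quadraticChar F a else 0 := by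
  split_ifs with ht
  · simp [ht]
  · rw [← quadraticChar_sum_zero hF]
    exact Fintype.sum_equiv ((Equiv.mulLeft₀ t ht).trans (Equiv.addLeft a)) _ _ fun s => rfl

theorem sum_quadraticChar_mul_sq_add (hF : ringChar F ≠ 2) {a : F} (ha : a ≠ 0) (t : F) :
    ∑ x, quadraticChar F (a * x ^ 2 + t) =
      quadraticChar F a * (Fintype.card F * (if t = 0 then 1 else 0) - 1) := by
  have hs (s : F) : quadraticChar F s * quadraticChar F (a * s + t) =
      quadraticChar F (a + t * s⁻¹) - if s = 0 then quadraticChar F a else 0 := by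
    split_ifs with h
    · simp [h]
    · rw [show a * s + t = s * (a + t * s⁻¹) by field_simp, map_mul, ← mul_assoc, ← sq,
        quadraticChar_sq_one h]
      ring
  have hinv : ∑ s, quadraticChar F (a + t * s⁻¹) = ∑ s, quadraticChar F (a + t * s) :=
    Fintype.sum_equiv (Equiv.inv F) _ _ fun s => rfl
  have hlin := sum_quadraticChar_add_mul hF t a
  rw [if_neg ha] at hlin
  simp_rw [add_comm t] at hlin
  rw [sum_comp_sq_eq_sum_quadraticChar hF fun s => quadraticChar F (a * s + t)]
  simp_rw [add_mul, one_mul, hs]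
  rw [Finset.sum_add_distrib, Finset.sum_sub_distrib, hlin, hinv, sum_quadraticChar_add_mul hF]
  simp only [Finset.sum_ite_eq', Finset.mem_univ, if_true]
  split_ifs <;> ring

theorem sum_ite_mul_sq_add_eq_zero (hF : ringChar F ≠ 2) {a : F} (ha : a ≠ 0) (t : F) :
    ∑ x, (if a * x ^ 2 + t = 0 then 1 else 0 : ℤ) = 1 + quadraticChar F (-(a * t)) := by
  rw [sum_comp_sq_eq_sum_quadraticChar hF fun s => if a * s + t = 0 then 1 else 0]
  have hs (s : F) : a * s + t = 0 ↔ s = -(t / a) := by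
    rw [← eq_neg_iff_add_eq_zero, ← neg_div, eq_div_iff ha, mul_comm]
  simp_rw [hs, mul_ite, mul_one, mul_zero]
  rw [Finset.sum_ite_eq' Finset.univ, if_pos (Finset.mem_univ _),
    show -(a * t) = a ^ 2 * -(t / a) by field_simp, map_mul, quadraticChar_sq_one' ha, one_mul]

theorem sum_ite_binary_eq_zero (hF : ringChar F ≠ 2) {b c : F} (hb : b ≠ 0) (hc : c ≠ 0) :
    ∑ y, ∑ z, (if b * y ^ 2 + c * z ^ 2 = 0 then 1 else 0 : ℤ) =
      Fintype.card F + quadraticChar F (-(b * c)) * (Fintype.card F - 1) := by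
  rw [Finset.sum_comm]
  simp_rw [sum_ite_mul_sq_add_eq_zero hF hb]
  have h := sum_quadraticChar_mul_sq_add hF (neg_ne_zero.2 (mul_ne_zero hb hc)) 0
  simp_rw [add_zero, if_true, mul_one] at h
  rw [Finset.sum_add_distrib, ← h]
  simp [mul_assoc]

theorem sum_quadraticChar_ternary (hF : ringChar F ≠ 2) {a b c : F}
    (ha : a ≠ 0) (hb : b ≠ 0) (hc : c ≠ 0) :
    ∑ y, ∑ z, ∑ x, quadraticChar F (a * x ^ 2 + (b * y ^ 2 + c * z ^ 2)) =
      Fintype.card F * (Fintype.card F - 1) * quadraticChar F (-(a * b * c)) := by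
  simp_rw [sum_quadraticChar_mul_sq_add hF ha, ← Finset.mul_sum, Finset.sum_sub_distrib,
    ← Finset.mul_sum, sum_ite_binary_eq_zero hF hb hc]
  rw [show -(a * b * c) = a * -(b * c) by ring, map_mul]
  simp only [Finset.sum_const, Finset.card_univ, nsmul_eq_mul]
  ring

theorem sum_ite_ternary_eq_zero (hF : ringChar F ≠ 2) {a b c : F}
    (ha : a ≠ 0) (hb : b ≠ 0) (hc : c ≠ 0) :
    ∑ y, ∑ z, ∑ x, (if a * x ^ 2 + (b * y ^ 2 + c * z ^ 2) = 0 then 1 else 0 : ℤ) =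
      Fintype.card F ^ 2 := by
  simp_rw [sum_ite_mul_sq_add_eq_zero hF ha]
  have h (y z : F) : quadraticChar F (-(a * (b * y ^ 2 + c * z ^ 2))) =
      quadraticChar F (-(a * c) * z ^ 2 + -(a * b) * y ^ 2) := by
    congr 1; ring
  have h0 (y : F) : -(a * b) * y ^ 2 = 0 ↔ y = 0 := by simp [ha, hb]
  simp_rw [h, Finset.sum_add_distrib,
    sum_quadraticChar_mul_sq_add hF (neg_ne_zero.2 (mul_ne_zero ha hc)), ← Finset.mul_sum,
    Finset.sum_sub_distrib, ← Finset.mul_sum, h0]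
  simp [sq]

end SumsOverFiniteField

theorem Projectivization.sum_eq_add_card_sub_one_mul_sum_rep {F V : Type*} [Field F] [Fintype F]
    [AddCommGroup V] [Module F V] [Fintype V] [Fintype (Projectivization F V)] (g : V → ℤ)
    (hg : ∀ (u : Fˣ) (v : V), g (u • v) = g v) :
    ∑ v, g v = g 0 + (Fintype.card F - 1) * ∑ x : Projectivization F V, g x.rep := by
  classical
  have hu : ((Fintype.card F : ℤ) - 1) = Fintype.card Fˣ := by
    rw [Fintype.card_units, Nat.cast_sub Fintype.card_pos, Nat.cast_one]
  rw [Fintype.sum_eq_add_sum_subtype_ne g 0, hu, Finset.mul_sum]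
  congr 1
  have hsum : ∑ t : Projectivization F V × Fˣ, g t.1.rep = ∑ v : {v : V // v ≠ 0}, g v := by
    refine Fintype.sum_bijective
      (fun t => ⟨t.2 • t.1.rep, (smul_ne_zero_iff_ne t.2).2 t.1.rep_nonzero⟩)
      ⟨fun s t h => ?_, fun v => ?_⟩ _ _ fun t => (hg _ _).symm
    · have h : s.2 • s.1.rep = t.2 • t.1.rep := congrArg Subtype.val h
      have h1 : s.1 = t.1 := by
        rw [← s.1.mk_rep, ← t.1.mk_rep, Projectivization.mk_eq_mk_iff]
        exact ⟨s.2⁻¹ * t.2, by rw [mul_smul, ← h, inv_smul_smul]⟩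
      refine Prod.ext h1 (Units.ext ?_)
      rw [h1] at h
      exact smul_left_injective F t.1.rep_nonzero h
    · obtain ⟨u, hu⟩ := Projectivization.exists_smul_eq_mk_rep F v.1 v.2
      exact ⟨(Projectivization.mk F v.1 v.2, u⁻¹), Subtype.ext (by simp [← hu])⟩
  rw [← hsum, Fintype.sum_prod_type]
  simp

section TernaryQuadraticForm

variable {F : Type*} [Field F]

open QuadraticMap

theorem QuadraticForm.toMatrix'_apply_eq_div [Invertible (2 : F)] {n : Type*} [Fintype n]
    [DecidableEq n] (Q : QuadraticForm F (n → F)) (i j : n) :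
    Q.toMatrix' i j =
      (Q (Pi.single i 1 + Pi.single j 1) - Q (Pi.single i 1) - Q (Pi.single j 1)) / 2 := by
  rw [toMatrix', LinearMap.toMatrix₂'_apply, eq_div_iff (Invertible.ne_zero 2), mul_comm,
    ← Nat.cast_ofNat (R := F), ← nsmul_eq_mul]
  exact LinearMap.congr_fun₂ (two_nsmul_associated F Q) (Pi.single i 1) (Pi.single j 1)

theorem QuadraticForm.discr'_weightedSumSquares [Invertible (2 : F)] {n : Type*} [Fintype n]
    [DecidableEq n] (w : n → F) : discr' (weightedSumSquares F w) = ∏ i, w i := by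
  rw [discr', ← Matrix.det_diagonal]
  congr 1
  ext i j
  have h2 : (2 : F) ≠ 0 := Invertible.ne_zero 2
  rw [toMatrix'_apply_eq_div, div_eq_iff h2]
  simp only [weightedSumSquares_apply, Pi.add_apply, ← Finset.sum_sub_distrib, smul_eq_mul]
  have h (k : n) (x y : F) :
      w k * ((x + y) * (x + y)) - w k * (x * x) - w k * (y * y) = w k * x * y * 2 := by ring
  simp_rw [h, ← Finset.sum_mul, Pi.single_apply]
  by_cases hij : i = j
  · simp [hij]
  · simp [hij, Ne.symm hij]

theorem QuadraticForm.exists_ternary_diagonalization [Invertible (2 : F)]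
    (Q : QuadraticForm F (Fin 3 → F)) :
    ∃ (w : Fin 3 → F) (f : (Fin 3 → F) ≃ₗ[F] (Fin 3 → F)) (e : F),
      (∀ v, Q v = ∑ i, w i * f v i ^ 2) ∧ Q.discr' = e ^ 2 * ∏ i, w i := by
  have key : ∃ w : Fin 3 → F, Equivalent Q (weightedSumSquares F w) := by
    have h := Q.equivalent_weightedSumSquares
    rwa [Module.finrank_fin_fun] at h
  obtain ⟨w, ⟨f⟩⟩ := key
  have hf (v) : Q v = weightedSumSquares F w (f v) := (f.map_app v).symm
  refine ⟨w, f.toLinearEquiv, f.toLinearEquiv.toLinearMap.toMatrix'.det, fun v => ?_, ?_⟩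
  · rw [hf, weightedSumSquares_apply]
    exact Finset.sum_congr rfl fun i _ => by rw [pow_two]; rfl
  · have hQ : Q = (weightedSumSquares F w).comp f.toLinearEquiv.toLinearMap :=
      QuadraticMap.ext hf
    conv_lhs => rw [hQ]
    rw [discr'_comp, discr'_weightedSumSquares, pow_two]

theorem QuadraticForm.sum_comp_ternary [Fintype F] [DecidableEq F] (hF : ringChar F ≠ 2) [Invertible (2 : F)]
    (Q : QuadraticForm F (Fin 3 → F)) (hQ : Q.discr' ≠ 0) :
    ∑ v, quadraticChar F (Q v) =
        Fintype.card F * (Fintype.card F - 1) * quadraticChar F (-Q.discr') ∧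
      ∑ v, (if Q v = 0 then 1 else 0 : ℤ) = Fintype.card F ^ 2 := by
  obtain ⟨w, f, e, hf, hd⟩ := Q.exists_ternary_diagonalization
  have he : e ≠ 0 := by rintro rfl; simp [hd] at hQ
  have hw (i) : w i ≠ 0 := fun h => hQ <| by
    rw [hd, Finset.prod_eq_zero (Finset.mem_univ i) h, mul_zero]
  have hsum (g : F → ℤ) : ∑ v, g (Q v) =
      ∑ y, ∑ z, ∑ x, g (w 0 * x ^ 2 + (w 1 * y ^ 2 + w 2 * z ^ 2)) := by
    rw [Fintype.sum_equiv f.toEquiv (fun v => g (Q v)) (fun v => g (∑ i, w i * v i ^ 2))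
      fun v => by rw [hf]; rfl, sum_fin_three]
    simp [Fin.sum_univ_three, add_assoc]
  constructor
  · rw [hsum, sum_quadraticChar_ternary hF (hw 0) (hw 1) (hw 2), hd, Fin.prod_univ_three,
      ← mul_neg (e ^ 2), map_mul _ (e ^ 2), quadraticChar_sq_one' he, one_mul]
  · rw [hsum fun t => if t = 0 then 1 else 0, sum_ite_ternary_eq_zero hF (hw 0) (hw 1) (hw 2)]

end TernaryQuadraticForm


/-- Let `p` be an odd prime and `Q` a quadratic form on `(F_p)³` whose polar bilinear form
`B(x,y) = (Q(x+y) - Q(x) - Q(y))/2` has Gram matrix of determinant `d ≠ 0`.  Then the number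
of projective points with `Q = 0` is `p + 1`, and for `ε = ±1` the number of projective points
with `χ(Q(x)) = ε` is `p (p + ε χ(-d)) / 2`, where `χ` is the quadratic character of `F_p`. -/
theorem stmt_0 (p : ℕ) [Fact p.Prime] (hp2 : p ≠ 2)
    (Q : QuadraticForm (ZMod p) (Fin 3 → ZMod p))
    (d : ZMod p)
    (hd : d = (Matrix.of fun i j : Fin 3 =>
      (Q (Pi.single i 1 + Pi.single j 1) - Q (Pi.single i 1) - Q (Pi.single j 1)) / 2).det)
    (hdne : d ≠ 0) :
    Nat.card {x : Projectivization (ZMod p) (Fin 3 → ZMod p) // Q x.rep = 0} = p + 1 ∧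
    ∀ ε : ℤ, ε = 1 ∨ ε = -1 →
      2 * (Nat.card {x : Projectivization (ZMod p) (Fin 3 → ZMod p) //
            quadraticChar (ZMod p) (Q x.rep) = ε} : ℤ)
        = p * (p + ε * quadraticChar (ZMod p) (-d)) := by
  have hF : ringChar (ZMod p) ≠ 2 := by rwa [ZMod.ringChar_zmod_n]
  let : Invertible (2 : ZMod p) := invertibleOfNonzero (Ring.two_ne_zero hF)
  let := Fintype.ofFinite (Projectivization (ZMod p) (Fin 3 → ZMod p))
  have hdisc : d = Q.discr' := by
    rw [hd, QuadraticForm.discr']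
    congr 1
    ext i j
    exact (Q.toMatrix'_apply_eq_div i j).symm
  obtain ⟨hS, hZ⟩ := Q.sum_comp_ternary hF (hdisc ▸ hdne)
  rw [← hdisc] at hS
  have hp1 : (p : ℤ) - 1 ≠ 0 := by
    have := (Fact.out : p.Prime).one_lt
    omega
  have hinv (u : (ZMod p)ˣ) (v : Fin 3 → ZMod p) : Q (u • v) = (u : ZMod p) ^ 2 * Q v := by
    rw [Units.smul_def, QuadraticMap.map_smul, smul_eq_mul, sq]
  rw [Projectivization.sum_eq_add_card_sub_one_mul_sum_rep (fun v => quadraticChar (ZMod p) (Q v))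
    fun u v => by rw [hinv, map_mul, quadraticChar_sq_one' u.ne_zero, one_mul],
    QuadraticMap.map_zero, quadraticChar_zero, zero_add, ZMod.card, mul_comm (p : ℤ), mul_assoc,
    mul_right_inj' hp1] at hS
  rw [Projectivization.sum_eq_add_card_sub_one_mul_sum_rep (F := ZMod p)
    (fun v => if Q v = 0 then (1 : ℤ) else 0) fun u v => by simp [hinv], QuadraticMap.map_zero,
    if_pos rfl, ZMod.card] at hZ
  have hZ' : ∑ x : Projectivization (ZMod p) (Fin 3 → ZMod p),
      (if Q x.rep = 0 then 1 else 0 : ℤ) = p + 1 :=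
    mul_left_cancel₀ hp1 (by linear_combination hZ)
  have hP : (Fintype.card (Projectivization (ZMod p) (Fin 3 → ZMod p)) : ℤ) = 1 + p + p ^ 2 := by
    rw [← Nat.card_eq_fintype_card, Projectivization.card_of_finrank _ _ (Module.finrank_fin_fun _)]
    simp [Finset.sum_range_succ]
  refine ⟨?_, fun ε hε => ?_⟩
  · rw [Nat.card_eq_fintype_card, Fintype.card_subtype]
    rw [Finset.sum_boole] at hZ'
    exact_mod_cast hZ'
  · have hpt (t : ZMod p) : 2 * (if quadraticChar (ZMod p) t = ε then 1 else 0 : ℤ) =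
        1 - (if t = 0 then 1 else 0) + ε * quadraticChar (ZMod p) t := by
      by_cases ht : t = 0
      · rcases hε with rfl | rfl <;> simp [ht]
      · rcases hε with rfl | rfl <;> rcases quadraticChar_dichotomy ht with h | h <;> simp [h, ht]
    rw [Nat.card_eq_fintype_card, Fintype.card_subtype, ← Finset.sum_boole, Finset.mul_sum]
    simp_rw [hpt]
    rw [Finset.sum_add_distrib, Finset.sum_sub_distrib, ← Finset.mul_sum, hS, hZ']
    simp only [Finset.sum_const, Finset.card_univ, nsmul_eq_mul, hP]
    ring
end

section
/- Let p be an odd prime and let f be a positive definite integral ternary quadratic form on ℤ³ with Gram matrix A such that p does not divide 4·det(A). Let v ∈ ℤ³ with v ∉ pℤ³, and let M = {x ∈ ℤ³ : x ≡ tv (mod pℤ³) for some t ∈ ℤ}, a subgroup of ℤ³ of index p². Let A_M denote a Gram matrix of f restricted to M with respect to any ℤ-basis of M. Then: (i) if p ∤ f(v), the matrix A_M is ℤ_p-equivalent to the diagonal matrix diag(f(v), -p²·f(v), -p²·det(A)); (ii) if p | f(v), the matrix A_M is ℤ_p-equivalent to diag(p, -p, -p²·det(A)). -/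
open Matrix

noncomputable section

/-- The image of an integral matrix in the rational matrices. -/
def intMap (X : Matrix (Fin 3) (Fin 3) ℤ) : Matrix (Fin 3) (Fin 3) ℚ :=
  X.map fun a => (a : ℚ)

/-- The value of the quadratic form with Gram matrix `A` at an integral vector `x`. -/
def qf (A : Matrix (Fin 3) (Fin 3) ℚ) (x : Fin 3 → ℤ) : ℚ :=
  (fun i => (x i : ℚ)) ⬝ᵥ A.mulVec fun i => (x i : ℚ)

/-- A rational symmetric matrix is half-integral: integral diagonal, off-diagonal in (1/2)ℤ. -/
def HalfIntegral (A : Matrix (Fin 3) (Fin 3) ℚ) : Prop :=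
  (∀ i, ∃ n : ℤ, A i i = n) ∧ ∀ i j, ∃ n : ℤ, 2 * A i j = n

/-- `A` is symmetric and positive definite. -/
def PosDef3 (A : Matrix (Fin 3) (Fin 3) ℚ) : Prop :=
  A.IsSymm ∧ ∀ x : Fin 3 → ℚ, x ≠ 0 → 0 < x ⬝ᵥ A.mulVec x

/-- `r(K, L)`: the number of representations of the form with Gram matrix `A` by the form
with Gram matrix `B`. -/
def repNum (A B : Matrix (Fin 3) (Fin 3) ℚ) : ℕ :=
  Nat.card {X : Matrix (Fin 3) (Fin 3) ℤ // (intMap X)ᵀ * B * intMap X = A}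

/-- `o(L)`: the number of integral automorphs of the form with Gram matrix `A`. -/
def autNum (A : Matrix (Fin 3) (Fin 3) ℚ) : ℕ :=
  Nat.card {X : Matrix (Fin 3) (Fin 3) ℤ // IsUnit X.det ∧ (intMap X)ᵀ * A * intMap X = A}

/-- `r(n, f)`: the number of representations of the integer `n` by the form with
Gram matrix `A`. -/
def rEval (A : Matrix (Fin 3) (Fin 3) ℚ) (n : ℤ) : ℕ :=
  Nat.card {x : Fin 3 → ℤ // qf A x = (n : ℚ)}

/-- ℤ-equivalence of Gram matrices. -/
def ZEquiv (A B : Matrix (Fin 3) (Fin 3) ℚ) : Prop :=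
  ∃ X : Matrix (Fin 3) (Fin 3) ℤ, IsUnit X.det ∧ (intMap X)ᵀ * A * intMap X = B

/-- The Watson set `Λ_p(A) = {x ∈ ℤ³ : f_A(x + z) ≡ f_A(z) (mod p) for all z ∈ ℤ³}`. -/
def LamSet (p : ℕ) (A : Matrix (Fin 3) (Fin 3) ℚ) : Set (Fin 3 → ℤ) :=
  {x | ∀ z : Fin 3 → ℤ, ∃ k : ℤ, qf A (x + z) - qf A z = (p : ℚ) * k}

/-- ℤ_q-equivalence of rational Gram matrices (inside ℚ_q). -/
def ZqEquiv (q : ℕ) [Fact q.Prime] (A B : Matrix (Fin 3) (Fin 3) ℚ) : Prop :=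
  ∃ X : Matrix (Fin 3) (Fin 3) ℤ_[q], IsUnit X.det ∧
    (X.map fun a => (a : ℚ_[q]))ᵀ * A.map (fun a => (a : ℚ_[q])) * X.map (fun a => (a : ℚ_[q]))
      = B.map fun a => (a : ℚ_[q])

/-- ℤ_q-equivalence of a rational Gram matrix to a q-adic target matrix. -/
def ZpEquivTo (q : ℕ) [Fact q.Prime] (A : Matrix (Fin 3) (Fin 3) ℚ)
    (B : Matrix (Fin 3) (Fin 3) ℚ_[q]) : Prop :=
  ∃ X : Matrix (Fin 3) (Fin 3) ℤ_[q], IsUnit X.det ∧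
    (X.map fun a => (a : ℚ_[q]))ᵀ * A.map (fun a => (a : ℚ_[q])) * X.map (fun a => (a : ℚ_[q])) = B

/-- The block diagonal matrix `H ⊕ [c]` with `H = [[0,1/2],[1/2,0]]`. -/
def Hblock (q : ℕ) [Fact q.Prime] (c : ℚ_[q]) : Matrix (Fin 3) (Fin 3) ℚ_[q] :=
  !![0, 1/2, 0; 1/2, 0, 0; 0, 0, c]

namespace Matrix

variable {R : Type*} [CommRing R] {a : Matrix (Fin 3) (Fin 3) R}

lemma toBilin'_comm (hs : a.IsSymm)
    (x y : Fin 3 → R) : a.toBilin' x y = a.toBilin' y x := by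
  rw [toBilin'_apply', toBilin'_apply', dotProduct_mulVec, ← mulVec_transpose, hs.eq,
    dotProduct_comm]

lemma toBilin'_adjugate_cross (x y z : Fin 3 → R) :
    a.toBilin' x (a.adjugate *ᵥ (y ⨯₃ z)) = a.det * (x ⬝ᵥ y ⨯₃ z) := by
  rw [toBilin'_apply', mulVec_mulVec, mul_adjugate, smul_mulVec, one_mulVec, dotProduct_smul,
    smul_eq_mul]

lemma toBilin'_adjugate_cross_self (hs : a.IsSymm) (x y : Fin 3 → R) :
    a.toBilin' (a.adjugate *ᵥ (x ⨯₃ y)) (a.adjugate *ᵥ (x ⨯₃ y)) =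
      a.det * (a.toBilin' x x * a.toBilin' y y - a.toBilin' x y ^ 2) := by
  rw [toBilin'_adjugate_cross]
  congr 1
  have h10 := hs.apply 0 1
  have h20 := hs.apply 0 2
  have h21 := hs.apply 1 2
  simp only [toBilin'_apply, adjugate_fin_three, cross_apply, dotProduct, mulVec,
    Fin.sum_univ_three, of_apply, cons_val', cons_val_zero, cons_val_one, cons_val, h10, h20, h21]
  ring

/-- If all columns of a `3 × 3` matrix are multiples of a fixed vector modulo `p`, then `p ^ 2`
divides its determinant. -/
lemma sq_dvd_det_of_columns {p : R} {v : Fin 3 → R}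
    {Y : Matrix (Fin 3) (Fin 3) R} (h : ∀ j, ∃ t, ∀ i, p ∣ Y i j - t * v i) :
    p ^ 2 ∣ Y.det := by
  choose t w hw using h
  have hY : ∀ i j, Y i j = t j * v i + p * w j i := fun i j => by
    rw [← hw j i]; ring
  refine ⟨t 0 * det (of ![v, w 1, w 2]) + t 1 * det (of ![w 0, v, w 2]) +
    t 2 * det (of ![w 0, w 1, v]) + p * det (of w), ?_⟩
  simp only [det_fin_three, hY, of_apply, cons_val_zero, cons_val_one, cons_val]
  ring

end Matrix

namespace PadicInt

variable {p : ℕ} [Fact p.Prime]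

lemma isUnit_iff_not_prime_dvd {x : ℤ_[p]} : IsUnit x ↔ ¬ (p : ℤ_[p]) ∣ x := by
  rw [← norm_lt_one_iff_dvd, ← not_isUnit_iff, not_not]

lemma isUnit_intCast_iff {n : ℤ} : IsUnit (n : ℤ_[p]) ↔ ¬ (p : ℤ) ∣ n := by
  rw [← norm_intCast_lt_one_iff, ← not_isUnit_iff, not_not]

lemma isUnit_two (hp : p ≠ 2) : IsUnit (2 : ℤ_[p]) := by
  have h : ¬ (p : ℤ) ∣ 2 := by
    exact_mod_cast fun h => hp ((Nat.prime_dvd_prime_iff_eq Fact.out Nat.prime_two).1 h)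
  exact_mod_cast isUnit_intCast_iff.2 h

lemma exists_isUnit_toBilin' {a : Matrix (Fin 3) (Fin 3) ℤ_[p]} (ha : IsUnit a.det)
    {x : Fin 3 → ℤ_[p]} (hx : ∃ i, IsUnit (x i)) : ∃ w, IsUnit (a.toBilin' x w) := by
  by_contra! h
  obtain ⟨i, hi⟩ := hx
  have hdvd : ∀ j, (p : ℤ_[p]) ∣ (x ᵥ* a) j := fun j => by
    have := h (Pi.single j 1)
    rwa [isUnit_iff_not_prime_dvd, not_not, toBilin'_apply', dotProduct_mulVec,
      dotProduct_single_one] at this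
  have key : a.det * x i = ((x ᵥ* a) ᵥ* a.adjugate) i := by
    rw [vecMul_vecMul, mul_adjugate, vecMul_smul, vecMul_one]; rfl
  refine isUnit_iff_not_prime_dvd.1 (ha.mul hi) ?_
  rw [key]
  exact Finset.dvd_sum (s := Finset.univ) (f := fun j => (x ᵥ* a) j * a.adjugate j i)
    fun j _ => (hdvd j).mul_right _

/-- Over `ℤ_[p]` a quadratic polynomial with constant term divisible by `p` and linear coefficient
a unit has a root divisible by `p`. -/
lemma exists_root_quadratic {c b q : ℤ_[p]} (hc : (p : ℤ_[p]) ∣ c) (hb : IsUnit b) :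
    ∃ s, (p : ℤ_[p]) ∣ s ∧ c + b * s + q * s ^ 2 = 0 := by
  open Polynomial in
  let F : ℤ_[p][X] := C c + C b * X + C q * X ^ 2
  have hF : ∀ s, F.aeval s = c + b * s + q * s ^ 2 := fun s => by simp [F]
  have hF' : (Polynomial.derivative F).aeval (0 : ℤ_[p]) = b := by simp [F]
  have hc' := (norm_lt_one_iff_dvd c).2 hc
  have hb' := isUnit_iff.1 hb
  obtain ⟨s, hs, hs', -⟩ := hensels_lemma (F := F) (a := (0 : ℤ_[p]))
    (by rw [hF, hF', hb']; simpa using hc')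
  rw [hF', hb', sub_zero] at hs'
  exact ⟨s, (norm_lt_one_iff_dvd s).1 hs', by rw [← hF, hs]⟩

lemma exists_isotropic_lift (hp : p ≠ 2) {a : Matrix (Fin 3) (Fin 3) ℤ_[p]} (hs : a.IsSymm)
    (ha : IsUnit a.det) {x : Fin 3 → ℤ_[p]} (hx : ∃ i, IsUnit (x i))
    (hxx : (p : ℤ_[p]) ∣ a.toBilin' x x) :
    ∃ y, a.toBilin' (x + (p : ℤ_[p]) • y) (x + (p : ℤ_[p]) • y) = 0 := by
  obtain ⟨w, hw⟩ := exists_isUnit_toBilin' ha hx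
  obtain ⟨s, ⟨r, rfl⟩, h⟩ :=
    exists_root_quadratic (q := a.toBilin' w w) hxx ((isUnit_two hp).mul hw)
  refine ⟨r • w, ?_⟩
  simp only [map_add, LinearMap.add_apply, map_smul, LinearMap.smul_apply, smul_eq_mul,
    toBilin'_comm hs w x]
  linear_combination h

/-- Every ternary quadratic form over `ℤ_[p]` has a primitive zero modulo `p`. -/
lemma exists_primitive_zero_mod (a : Matrix (Fin 3) (Fin 3) ℤ_[p]) :
    ∃ x : Fin 3 → ℤ_[p], (∃ i, IsUnit (x i)) ∧ (p : ℤ_[p]) ∣ a.toBilin' x x := by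
  have hker : ∀ z : ℤ_[p], toZMod z = 0 ↔ (p : ℤ_[p]) ∣ z := fun z => by
    rw [← RingHom.mem_ker, ker_toZMod, maximalIdeal_eq_span_p, Ideal.mem_span_singleton]
  let F : MvPolynomial (Fin 3) (ZMod p) :=
    ∑ i, ∑ j, MvPolynomial.C (toZMod (a i j)) * (MvPolynomial.X i * MvPolynomial.X j)
  have hF : ∀ x : Fin 3 → ℤ_[p],
      MvPolynomial.eval (fun i => toZMod (x i)) F = toZMod (a.toBilin' x x) := fun x => by
    simp only [F, toBilin'_apply, map_sum, map_mul, MvPolynomial.eval_C, MvPolynomial.eval_X]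
    exact Finset.sum_congr rfl fun i _ => Finset.sum_congr rfl fun j _ => by ring
  have hdeg : F.totalDegree < Fintype.card (Fin 3) := by
    have : F.totalDegree ≤ 2 := by
      refine MvPolynomial.totalDegree_finsetSum_le fun i _ =>
        MvPolynomial.totalDegree_finsetSum_le fun j _ => ?_
      refine (MvPolynomial.totalDegree_mul _ _).trans ?_
      rw [MvPolynomial.totalDegree_C, zero_add]
      refine (MvPolynomial.totalDegree_mul _ _).trans ?_
      simp [MvPolynomial.totalDegree_X]
    rw [Fintype.card_fin]; omega
  have hcard := char_dvd_card_solutions p hdeg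
  have h0 : MvPolynomial.eval 0 F = 0 := by
    have := hF 0
    simpa using this
  have hone : 1 < Fintype.card {x : Fin 3 → ZMod p // MvPolynomial.eval x F = 0} :=
    (Fact.out : p.Prime).one_lt.trans_le (Nat.le_of_dvd (Fintype.card_pos_iff.2 ⟨⟨0, h0⟩⟩) hcard)
  obtain ⟨⟨x, hx⟩, hne⟩ := Fintype.exists_ne_of_one_lt_card hone ⟨0, h0⟩
  obtain ⟨i, hi⟩ : ∃ i, x i ≠ 0 := Function.ne_iff.1 fun h => hne (Subtype.ext h)
  have hsurj : ∀ i, ∃ z : ℤ_[p], toZMod z = x i := fun i =>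
    ⟨((x i).val : ℤ_[p]), by rw [map_natCast, ZMod.natCast_zmod_val]⟩
  choose z hz using hsurj
  refine ⟨z, ⟨i, isUnit_iff_not_prime_dvd.2 fun h => hi ?_⟩, (hker _).1 ?_⟩
  · rw [← hz, (hker _).2 h]
  · rw [← hF, funext hz, hx]

/-- If `v` has unit norm then there is an isotropic vector not orthogonal to `v` modulo `p`. -/
lemma exists_isotropic_isUnit (hp : p ≠ 2) {a : Matrix (Fin 3) (Fin 3) ℤ_[p]} (hs : a.IsSymm)
    (ha : IsUnit a.det) {v : Fin 3 → ℤ_[p]} (hv : IsUnit (a.toBilin' v v)) :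
    ∃ e, a.toBilin' e e = 0 ∧ IsUnit (a.toBilin' v e) := by
  obtain ⟨x, ⟨i, hi⟩, hxx⟩ := exists_primitive_zero_mod a
  obtain ⟨y, he⟩ := exists_isotropic_lift hp hs ha ⟨i, hi⟩ hxx
  have hprim : ∃ i, IsUnit ((x + (p : ℤ_[p]) • y) i) := ⟨i, by
    rw [isUnit_iff_not_prime_dvd] at hi ⊢
    rwa [Pi.add_apply, Pi.smul_apply, smul_eq_mul, dvd_add_left (dvd_mul_right _ _)]⟩
  generalize x + (p : ℤ_[p]) • y = e at he hprim
  by_cases hve : IsUnit (a.toBilin' v e)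
  · exact ⟨e, he, hve⟩
  have hve' := not_not.1 (mt isUnit_iff_not_prime_dvd.2 hve)
  obtain ⟨w, hew, hvw⟩ : ∃ w, IsUnit (a.toBilin' e w) ∧ IsUnit (a.toBilin' v w) := by
    obtain ⟨w, hw⟩ := exists_isUnit_toBilin' ha hprim
    by_cases hvw : IsUnit (a.toBilin' v w)
    · exact ⟨w, hw, hvw⟩
    refine ⟨w + v, ?_, ?_⟩
    · rw [isUnit_iff_not_prime_dvd] at hw ⊢
      rwa [map_add, toBilin'_comm hs e v, dvd_add_left hve']
    · rw [isUnit_iff_not_prime_dvd] at hvw hv ⊢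
      rwa [map_add, dvd_add_right (not_not.1 hvw)]
  obtain ⟨c, hc⟩ := ((isUnit_two hp).mul hew).exists_right_inv
  refine ⟨w - (a.toBilin' w w * c) • e, ?_, ?_⟩
  · simp only [map_sub, LinearMap.sub_apply, map_smul, LinearMap.smul_apply, smul_eq_mul, he,
      toBilin'_comm hs w e]
    linear_combination -a.toBilin' w w * hc
  · rw [isUnit_iff_not_prime_dvd] at hvw ⊢
    rwa [map_sub, map_smul, smul_eq_mul, dvd_sub_left (hve'.mul_left _)]

end PadicInt

/-- A family of `p`-adic vectors in the lattice `ℤ_[p] v + p ℤ_[p]³` whose Gram determinant has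
the right valuation is a basis of the `p`-adic completion of the lattice spanned by `Y`. -/
lemma zpEquivTo_of_orthogonal {p : ℕ} [Fact p.Prime] {A : Matrix (Fin 3) (Fin 3) ℚ}
    {v : Fin 3 → ℤ} {Y : Matrix (Fin 3) (Fin 3) ℤ}
    (hY : ∀ x : Fin 3 → ℤ,
      (∃ c : Fin 3 → ℤ, x = Y.mulVec c) ↔ ∃ t : ℤ, ∀ i, (p : ℤ) ∣ (x i - t * v i))
    {a : Matrix (Fin 3) (Fin 3) ℤ_[p]} (haA : ∀ i j, (a i j : ℚ_[p]) = (A i j : ℚ_[p]))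
    {z : Fin 3 → Fin 3 → ℤ_[p]}
    (hz : ∀ j, ∃ (t : ℤ_[p]) (w : Fin 3 → ℤ_[p]),
      z j = t • (fun i => (v i : ℤ_[p])) + (p : ℤ_[p]) • w)
    {d : Fin 3 → ℤ_[p]} (hd : ∀ i j, a.toBilin' (z i) (z j) = diagonal d i j)
    {u : ℤ_[p]} (hu : IsUnit u) (hdu : ∏ i, d i = (p : ℤ_[p]) ^ 4 * u) :
    ZpEquivTo p ((intMap Y)ᵀ * A * intMap Y) (diagonal fun i => (d i : ℚ_[p])) := by
  have hp0 : (p : ℤ_[p]) ≠ 0 := Nat.cast_ne_zero.2 (Fact.out : p.Prime).ne_zero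
  let y : Matrix (Fin 3) (Fin 3) ℤ_[p] := Y.map (Int.castRingHom ℤ_[p])
  have hcast : ∀ c : Fin 3 → ℤ, (fun i => ((Y *ᵥ c) i : ℤ_[p])) = y *ᵥ fun i => (c i : ℤ_[p]) :=
    fun c => funext fun i => RingHom.map_mulVec (Int.castRingHom ℤ_[p]) Y c i
  obtain ⟨c₀, hc₀⟩ := (hY v).2 ⟨1, fun i => by simp⟩
  have hC : ∀ k, ∃ c : Fin 3 → ℤ, Pi.single k (p : ℤ) = Y *ᵥ c := fun k =>
    (hY _).2 ⟨0, fun i => by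
      by_cases h : i = k
      · subst h; simp
      · simp [h]⟩
  choose C hC using hC
  have hspan : ∀ j, ∃ x, z j = y *ᵥ x := fun j => by
    obtain ⟨t, w, h⟩ := hz j
    refine ⟨t • (fun i => (c₀ i : ℤ_[p])) + ∑ k, w k • fun i => (C k i : ℤ_[p]), ?_⟩
    rw [h, mulVec_add, mulVec_smul, ← hcast, ← hc₀, mulVec_sum]
    simp only [mulVec_smul, ← hcast, ← hC]
    congr 1
    ext i
    fin_cases i <;> simp [Fin.sum_univ_three, mul_comm]
  choose x hx using hspan
  have hyX : y * (of x)ᵀ = (of z)ᵀ := by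
    ext i j
    simp [hx, mul_apply, mulVec, dotProduct]
  have hgram : (y * (of x)ᵀ)ᵀ * a * (y * (of x)ᵀ) = diagonal d := by
    rw [hyX, transpose_transpose]
    ext i j
    rw [← hd, toBilin'_apply', Matrix.mul_assoc]
    rfl
  refine ⟨(of x)ᵀ, ?_, ?_⟩
  · obtain ⟨e, he⟩ : ((p : ℤ) ^ 2) ∣ Y.det := sq_dvd_det_of_columns (v := v) fun j => by
      obtain ⟨t, ht⟩ := (hY _).1 ⟨Pi.single j 1, rfl⟩
      exact ⟨t, fun i => by simpa using ht i⟩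
    have hydet : y.det = (p : ℤ_[p]) ^ 2 * e := by
      have := RingHom.map_det (Int.castRingHom ℤ_[p]) Y
      rw [he] at this
      simpa [y] using this.symm
    have h := congrArg det hgram
    rw [det_mul, det_mul, det_transpose, det_mul, hydet, det_diagonal, hdu] at h
    have h' : (of x)ᵀ.det * (e ^ 2 * (of x)ᵀ.det * a.det) = u :=
      mul_left_cancel₀ (pow_ne_zero 4 hp0) (by linear_combination h)
    exact isUnit_of_mul_isUnit_left (h' ▸ hu)
  · have hA : (a.map fun r => (r : ℚ_[p])) = A.map fun r => (r : ℚ_[p]) := ext haA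
    have h := congrArg (fun m => m.map PadicInt.Coe.ringHom) hgram
    simp only [Matrix.map_mul, transpose_mul] at h
    have hYy : (y.map PadicInt.Coe.ringHom) = (intMap Y).map fun r => (r : ℚ_[p]) := by
      ext i j; simp [y, intMap]
    have hm : (((intMap Y)ᵀ * A * intMap Y).map fun r => (r : ℚ_[p])) =
        ((intMap Y).map fun r => (r : ℚ_[p]))ᵀ * (A.map fun r => (r : ℚ_[p])) *
          (intMap Y).map fun r => (r : ℚ_[p]) := by
      have := Matrix.map_mul (L := (intMap Y)ᵀ * A) (M := intMap Y) (f := Rat.castHom ℚ_[p])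
      rw [Matrix.map_mul] at this
      exact this
    rw [hm, ← hYy, ← hA]
    have hdiag : (diagonal d).map PadicInt.Coe.ringHom = diagonal fun i => (d i : ℚ_[p]) := by
      rw [diagonal_map (map_zero _)]; rfl
    rw [← hdiag, ← h]
    simp only [Matrix.mul_assoc]
    rfl

/-- A half-integral rational matrix has entries in `ℤ_[p]` for odd `p`. -/
lemma HalfIntegral.exists_padicInt {p : ℕ} [Fact p.Prime] (hp : p ≠ 2)
    {A : Matrix (Fin 3) (Fin 3) ℚ} (hA : HalfIntegral A) :
    ∃ a : Matrix (Fin 3) (Fin 3) ℤ_[p], ∀ i j, (a i j : ℚ_[p]) = (A i j : ℚ_[p]) := by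
  choose n hn using hA.2
  obtain ⟨c, hc⟩ := (PadicInt.isUnit_two hp).exists_right_inv
  have hc' : (2 : ℚ_[p]) * c = 1 := by exact_mod_cast congrArg (fun r : ℤ_[p] => (r : ℚ_[p])) hc
  refine ⟨of fun i j => n i j * c, fun i j => ?_⟩
  have h : (2 : ℚ_[p]) * (A i j : ℚ_[p]) = n i j := by
    exact_mod_cast congrArg (Rat.cast (K := ℚ_[p])) (hn i j)
  simp only [of_apply, PadicInt.coe_mul, PadicInt.coe_intCast, ← h]
  linear_combination (A i j : ℚ_[p]) * hc'

/-- A `p`-adic vector of unit norm extends to an orthogonal basis with norms `f(v), -f(v), -det`. -/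
lemma PadicInt.exists_orthogonal_of_isUnit {p : ℕ} [Fact p.Prime] (hp : p ≠ 2)
    {a : Matrix (Fin 3) (Fin 3) ℤ_[p]} (hs : a.IsSymm) (ha : IsUnit a.det) {v : Fin 3 → ℤ_[p]}
    (hv : IsUnit (a.toBilin' v v)) :
    ∃ u w, a.toBilin' u u = -a.toBilin' v v ∧ a.toBilin' w w = -a.det ∧
      a.toBilin' v u = 0 ∧ a.toBilin' v w = 0 ∧ a.toBilin' u w = 0 := by
  obtain ⟨e, he, hve⟩ := exists_isotropic_isUnit hp hs ha hv
  obtain ⟨b, hb⟩ := hve.exists_right_inv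
  obtain ⟨n, hn⟩ := hv.exists_right_inv
  obtain ⟨u, huu, hvu⟩ : ∃ u, a.toBilin' u u = -a.toBilin' v v ∧ a.toBilin' v u = 0 := by
    refine ⟨(a.toBilin' v v * b) • e - v, ?_, ?_⟩
    · simp only [map_sub, LinearMap.sub_apply, map_smul, LinearMap.smul_apply, smul_eq_mul, he,
        toBilin'_comm hs e v]
      linear_combination -2 * a.toBilin' v v * hb
    · simp only [map_sub, map_smul, smul_eq_mul]
      linear_combination a.toBilin' v v * hb
  refine ⟨u, n • (a.adjugate *ᵥ (v ⨯₃ u)), huu, ?_, hvu, ?_, ?_⟩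
  · simp only [map_smul, LinearMap.smul_apply, smul_eq_mul, toBilin'_adjugate_cross_self hs, huu,
      hvu]
    linear_combination -a.det * (a.toBilin' v v * n + 1) * hn
  · rw [map_smul, toBilin'_adjugate_cross, dot_self_cross, mul_zero, smul_zero]
  · rw [map_smul, toBilin'_adjugate_cross, dot_cross_self, mul_zero, smul_zero]

/-- A primitive vector of norm divisible by `p` is congruent to an isotropic vector that extends to
a basis with Gram matrix `[[0, 1], [1, 0]] ⊕ [-det]`. -/
lemma PadicInt.exists_hyperbolic_basis {p : ℕ} [Fact p.Prime] (hp : p ≠ 2)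
    {a : Matrix (Fin 3) (Fin 3) ℤ_[p]} (hs : a.IsSymm) (ha : IsUnit a.det) {v : Fin 3 → ℤ_[p]}
    (hv : ∃ i, IsUnit (v i)) (hvv : (p : ℤ_[p]) ∣ a.toBilin' v v) :
    ∃ y e f g, e = v + (p : ℤ_[p]) • y ∧ a.toBilin' e e = 0 ∧ a.toBilin' f f = 0 ∧
      a.toBilin' e f = 1 ∧ a.toBilin' g g = -a.det ∧ a.toBilin' e g = 0 ∧ a.toBilin' f g = 0 := by
  obtain ⟨y, he⟩ := exists_isotropic_lift hp hs ha hv hvv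
  obtain ⟨i, hi⟩ := hv
  have hprim : ∃ i, IsUnit ((v + (p : ℤ_[p]) • y) i) := ⟨i, by
    rw [isUnit_iff_not_prime_dvd] at hi ⊢
    rwa [Pi.add_apply, Pi.smul_apply, smul_eq_mul, dvd_add_left (dvd_mul_right _ _)]⟩
  obtain ⟨e, hev⟩ : ∃ e, e = v + (p : ℤ_[p]) • y := ⟨_, rfl⟩
  rw [← hev] at he hprim
  obtain ⟨w, hw⟩ := exists_isUnit_toBilin' ha hprim
  obtain ⟨b, hb⟩ := hw.exists_right_inv
  obtain ⟨c, hc⟩ := (isUnit_two hp).exists_right_inv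
  obtain ⟨f, hff, hef⟩ : ∃ f, a.toBilin' f f = 0 ∧ a.toBilin' e f = 1 := by
    refine ⟨b • w - (c * b ^ 2 * a.toBilin' w w) • e, ?_, ?_⟩
    · simp only [map_sub, LinearMap.sub_apply, map_smul, LinearMap.smul_apply, smul_eq_mul, he,
        toBilin'_comm hs w e]
      linear_combination -b ^ 2 * a.toBilin' w w * hc - 2 * c * b ^ 2 * a.toBilin' w w * hb
    · simp only [map_sub, map_smul, smul_eq_mul, he]
      linear_combination hb
  refine ⟨y, e, f, a.adjugate *ᵥ (e ⨯₃ f), hev, he, hff, hef, ?_, ?_, ?_⟩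
  · rw [toBilin'_adjugate_cross_self hs, he, hff, hef]
    ring
  · rw [toBilin'_adjugate_cross, dot_self_cross, mul_zero]
  · rw [toBilin'_adjugate_cross, dot_cross_self, mul_zero]

/-- Let `p` be an odd prime and `f` a positive definite integral ternary form with Gram matrix
`A` such that `p ∤ 4 det A`.  Let `v ∈ ℤ³ \ pℤ³` and let `M = {x : x ≡ tv (mod p)}`, with
a ℤ-basis given by the columns of `Y`, so that `A_M = Yᵀ A Y`.  If `p ∤ f(v)` then `A_M` is
ℤ_p-equivalent to `diag(f(v), -p² f(v), -p² det A)`; if `p ∣ f(v)` then `A_M` is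
ℤ_p-equivalent to `diag(p, -p, -p² det A)`. -/
theorem stmt_2 (p : ℕ) [Fact p.Prime] (hp2 : p ≠ 2)
    (A : Matrix (Fin 3) (Fin 3) ℚ) (hA : PosDef3 A) (hAh : HalfIntegral A)
    (D : ℤ) (hD : 4 * A.det = (D : ℚ)) (hpD : ¬ (p : ℤ) ∣ D)
    (v : Fin 3 → ℤ) (hv : ¬ ∀ i, (p : ℤ) ∣ v i)
    (Y : Matrix (Fin 3) (Fin 3) ℤ)
    (hY : ∀ x : Fin 3 → ℤ,
      (∃ c : Fin 3 → ℤ, x = Y.mulVec c) ↔ ∃ t : ℤ, ∀ i, (p : ℤ) ∣ (x i - t * v i))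
    (N : ℤ) (hN : qf A v = (N : ℚ)) :
    (¬ (p : ℤ) ∣ N →
      ZpEquivTo p ((intMap Y)ᵀ * A * intMap Y)
        (Matrix.diagonal
          ![((qf A v : ℚ) : ℚ_[p]), -(p : ℚ_[p]) ^ 2 * ((qf A v : ℚ) : ℚ_[p]),
            -(p : ℚ_[p]) ^ 2 * ((A.det : ℚ) : ℚ_[p])])) ∧
    ((p : ℤ) ∣ N →
      ZpEquivTo p ((intMap Y)ᵀ * A * intMap Y)
        (Matrix.diagonal
          ![(p : ℚ_[p]), -(p : ℚ_[p]), -(p : ℚ_[p]) ^ 2 * ((A.det : ℚ) : ℚ_[p])])) := by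
  obtain ⟨a, haA⟩ := hAh.exists_padicInt (p := p) hp2
  have hs : a.IsSymm := IsSymm.ext fun i j => PadicInt.ext (by rw [haA, haA, hA.1.apply])
  have hdet : (a.det : ℚ_[p]) = (A.det : ℚ_[p]) := by
    have h1 := RingHom.map_det PadicInt.Coe.ringHom a
    have h2 := RingHom.map_det (Rat.castHom ℚ_[p]) A
    have h3 : PadicInt.Coe.ringHom.mapMatrix a = (Rat.castHom ℚ_[p]).mapMatrix A := ext haA
    rw [h3, ← h2] at h1
    exact h1
  have ha : IsUnit a.det := by
    have h : 4 * a.det = (D : ℤ_[p]) := PadicInt.ext (by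
      rw [PadicInt.coe_mul, hdet]
      change (4 : ℚ_[p]) * (A.det : ℚ_[p]) = (D : ℚ_[p])
      exact_mod_cast congrArg (Rat.cast (K := ℚ_[p])) hD)
    exact isUnit_of_mul_isUnit_right (h ▸ PadicInt.isUnit_intCast_iff.2 hpD)
  set V : Fin 3 → ℤ_[p] := fun i => (v i : ℤ_[p]) with hV
  have hVV : ((a.toBilin' V V : ℤ_[p]) : ℚ_[p]) = (qf A v : ℚ) := by
    simp [qf, toBilin'_apply, dotProduct, mulVec, Fin.sum_univ_three, hV, haA]
    ring
  have hVN : a.toBilin' V V = (N : ℤ_[p]) := PadicInt.ext (by rw [hVV, hN]; simp)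
  have hprim : ∃ i, IsUnit (V i) := by
    obtain ⟨i, hi⟩ := not_forall.1 hv
    exact ⟨i, PadicInt.isUnit_intCast_iff.2 hi⟩
  refine ⟨fun hpN => ?_, fun hpN => ?_⟩
  · have hu : IsUnit (a.toBilin' V V) := hVN ▸ PadicInt.isUnit_intCast_iff.2 hpN
    obtain ⟨u, w, huu, hww, hvu, hvw, huw⟩ := PadicInt.exists_orthogonal_of_isUnit hp2 hs ha hu
    convert zpEquivTo_of_orthogonal hY haA (z := ![V, (p : ℤ_[p]) • u, (p : ℤ_[p]) • w])
      (d := ![a.toBilin' V V, -(p : ℤ_[p]) ^ 2 * a.toBilin' V V, -(p : ℤ_[p]) ^ 2 * a.det])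
      ?_ ?_ ((hu.pow 2).mul ha) ?_ using 2
    · ext i
      fin_cases i <;> simp [hVV, hdet]
    · intro j
      fin_cases j
      · exact ⟨1, 0, by simp [hV]⟩
      · exact ⟨0, u, by simp⟩
      · exact ⟨0, w, by simp⟩
    · intro i j
      fin_cases i <;> fin_cases j <;>
        simp [huu, hww, hvu, hvw, huw, toBilin'_comm hs u V, toBilin'_comm hs w V,
          toBilin'_comm hs w u] <;> ring
    · simp [Fin.prod_univ_three]
      ring
  · have hpV : (p : ℤ_[p]) ∣ a.toBilin' V V := by
      rw [hVN]
      exact_mod_cast Int.cast_dvd_cast (α := ℤ_[p]) (p : ℤ) N hpN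
    obtain ⟨y, e, f, g, hey, hee, hff, hef, hgg, heg, hfg⟩ :=
      PadicInt.exists_hyperbolic_basis hp2 hs ha hprim hpV
    obtain ⟨c, hc⟩ := (PadicInt.isUnit_two hp2).exists_right_inv
    convert zpEquivTo_of_orthogonal hY haA (z := ![e + ((p : ℤ_[p]) * c) • f,
        e - ((p : ℤ_[p]) * c) • f, (p : ℤ_[p]) • g])
      (d := ![(p : ℤ_[p]), -(p : ℤ_[p]), -(p : ℤ_[p]) ^ 2 * a.det]) ?_ ?_ ha ?_ using 2
    · ext i
      fin_cases i <;> simp [hdet]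
    · intro j
      fin_cases j
      · exact ⟨1, y + c • f, by simp [hey, hV, mul_smul, add_assoc]⟩
      · exact ⟨1, y - c • f, by simp [hey, hV, mul_smul, smul_sub, add_sub_assoc]⟩
      · exact ⟨0, g, by simp⟩
    · have hfe := toBilin'_comm hs f e
      have hge := toBilin'_comm hs g e
      have hgf := toBilin'_comm hs g f
      intro i j
      fin_cases i <;> fin_cases j <;>
        simp [hee, hff, hef, hgg, heg, hfg, hfe, hge, hgf]
      · linear_combination (p : ℤ_[p]) * hc
      · linear_combination -(p : ℤ_[p]) * hc
      · ring
    · simp [Fin.prod_univ_three]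
      ring
end
end

section
/- Let p be an odd prime, let f be a positive definite integral ternary quadratic form on ℤ³, let ε ∈ {0, 1, -1}, and let n be a positive integer whose Legendre symbol (n/p) equals ε (where (n/p) = 0 means p | n). For a point s = [v] ∈ P^2(F_p), let L_s = {x ∈ ℤ³ : x mod p ∈ F_p·v̄}, and let s_p(ε,f) = {[v] ∈ P^2(F_p) : (f(v)/p) = ε}, which is well defined. Then r(n,f) = Σ_{s ∈ s_p(ε,f)} #{x ∈ L_s : f(x) = n} − (|s_p(ε,f)| − 1) · #{x ∈ pℤ³ : f(x) = n}. -/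
noncomputable section

/-- The integral ternary quadratic form `f(x) = ∑_{i ≤ j} a_{ij} x_i x_j`. -/
def tf (a : Fin 3 → Fin 3 → ℤ) (x : Fin 3 → ℤ) : ℤ :=
  ∑ i, ∑ j, if i ≤ j then a i j * x i * x j else 0

/-- The reduction of the form `tf a` modulo `p`. -/
def tfBar (p : ℕ) (a : Fin 3 → Fin 3 → ℤ) (y : Fin 3 → ZMod p) : ZMod p :=
  ∑ i, ∑ j, if i ≤ j then (a i j : ZMod p) * y i * y j else 0

theorem tf_eq (a : Fin 3 → Fin 3 → ℤ) (x : Fin 3 → ℤ) :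
    tf a x = a 0 0 * x 0 ^ 2 + a 0 1 * x 0 * x 1 + a 0 2 * x 0 * x 2 + a 1 1 * x 1 ^ 2
      + a 1 2 * x 1 * x 2 + a 2 2 * x 2 ^ 2 := by
  simp [tf, Fin.sum_univ_three]
  ring

/-- Completing the square twice bounds the coordinates of the solutions of `f(x) = n`. -/
theorem finite_setOf_tf_eq (a : Fin 3 → Fin 3 → ℤ)
    (hpos : ∀ x : Fin 3 → ℤ, x ≠ 0 → 0 < tf a x) (n : ℤ) :
    Finite {x : Fin 3 → ℤ // tf a x = n} := by
  set A := 4 * a 0 0 * a 1 1 - a 0 1 ^ 2 with hA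
  set B := 4 * a 0 0 * a 1 2 - 2 * a 0 1 * a 0 2 with hB
  set C := 4 * a 0 0 * a 2 2 - a 0 2 ^ 2 with hC
  set D := 4 * A * C - B ^ 2 with hD
  have h0 : 0 < a 0 0 := by
    have h := hpos ![1, 0, 0] fun h => by simpa using congrFun h 0
    simpa [tf_eq] using h
  have hA0 : 0 < A := by
    have h := hpos ![-a 0 1, 2 * a 0 0, 0] fun h => h0.ne' (by simpa using congrFun h 1)
    have e : tf a ![-a 0 1, 2 * a 0 0, 0] = a 0 0 * A := by
      simp [tf_eq, hA]; ring
    rw [e] at h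
    exact pos_of_mul_pos_right h h0.le
  have hD0 : 0 < D := by
    have h := hpos ![a 0 1 * B - 2 * a 0 2 * A, -2 * a 0 0 * B, 4 * a 0 0 * A] fun h => by
      have := congrFun h 2
      simp [h0.ne', hA0.ne'] at this
    have e : tf a ![a 0 1 * B - 2 * a 0 2 * A, -2 * a 0 0 * B, 4 * a 0 0 * A]
        = a 0 0 * A * D := by
      simp [tf_eq, hD, hC, hB, hA]; ring
    rw [e] at h
    exact pos_of_mul_pos_right h (mul_pos h0 hA0).le
  let N := 16 * a 0 0 * A * n
  have key (x : {x : Fin 3 → ℤ // tf a x = n}) :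
      4 * A * (2 * a 0 0 * x.1 0 + a 0 1 * x.1 1 + a 0 2 * x.1 2) ^ 2
        + (2 * A * x.1 1 + B * x.1 2) ^ 2 + D * x.1 2 ^ 2 = N := by
    have h := x.2
    rw [tf_eq] at h
    simp only [N, ← h, hD, hC, hB, hA]
    ring
  have bound {c t : ℤ} (hc : 0 < c) (h : c * t ^ 2 ≤ N) : t ∈ Set.Icc (-N) N := by
    have h1 : t ^ 2 ≤ N := by nlinarith [sq_nonneg t]
    have h2 := Int.le_self_sq t
    have h3 := Int.le_self_sq (-t)
    rw [neg_sq] at h3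
    constructor <;> linarith
  let F (x : {x : Fin 3 → ℤ // tf a x = n}) :
      Set.Icc (-N) N × Set.Icc (-N) N × Set.Icc (-N) N :=
    have hx := key x
    have h1 := mul_nonneg (mul_pos four_pos hA0).le
      (sq_nonneg (2 * a 0 0 * x.1 0 + a 0 1 * x.1 1 + a 0 2 * x.1 2))
    have h2 := sq_nonneg (2 * A * x.1 1 + B * x.1 2)
    have h3 := mul_nonneg hD0.le (sq_nonneg (x.1 2))
    (⟨2 * a 0 0 * x.1 0 + a 0 1 * x.1 1 + a 0 2 * x.1 2,
        bound (mul_pos four_pos hA0) (by linarith)⟩,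
      ⟨2 * A * x.1 1 + B * x.1 2, bound one_pos (by linarith)⟩,
      ⟨x.1 2, bound hD0 (by linarith)⟩)
  refine Finite.of_injective F fun x y h => ?_
  simp only [F, Prod.mk.injEq, Subtype.mk.injEq] at h
  obtain ⟨e0, e1, e2⟩ := h
  rw [e2] at e1 e0
  have e1' : x.1 1 = y.1 1 :=
    mul_left_cancel₀ (mul_pos two_pos hA0).ne' (add_right_cancel e1)
  rw [e1'] at e0
  have e0' : x.1 0 = y.1 0 :=
    mul_left_cancel₀ (mul_pos two_pos h0).ne' (add_right_cancel (add_right_cancel e0))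
  ext i
  fin_cases i
  exacts [e0', e1', e2]

theorem tfBar_intCast (p : ℕ) (a : Fin 3 → Fin 3 → ℤ) (x : Fin 3 → ℤ) :
    tfBar p a (fun i => (x i : ZMod p)) = (tf a x : ZMod p) := by
  simp [tf, tfBar, Int.cast_sum, apply_ite (Int.cast : ℤ → ZMod p)]

theorem tfBar_smul (p : ℕ) (a : Fin 3 → Fin 3 → ℤ) (c : ZMod p) (y : Fin 3 → ZMod p) :
    tfBar p a (c • y) = c ^ 2 * tfBar p a y := by
  simp only [tfBar, Finset.mul_sum, Pi.smul_apply, smul_eq_mul, mul_ite, mul_zero]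
  refine Finset.sum_congr rfl fun i _ => Finset.sum_congr rfl fun j _ => ?_
  split_ifs <;> ring

theorem quadraticChar_tfBar_smul (p : ℕ) [Fact p.Prime] (a : Fin 3 → Fin 3 → ℤ) {c : ZMod p}
    (hc : c ≠ 0) (y : Fin 3 → ZMod p) :
    quadraticChar (ZMod p) (tfBar p a (c • y)) = quadraticChar (ZMod p) (tfBar p a y) := by
  rw [tfBar_smul, map_mul, quadraticChar_sq_one' hc, one_mul]

/-- A nonzero vector lies on exactly one line through the origin. -/
theorem exists_eq_smul_rep_iff {K V : Type*} [Field K] [AddCommGroup V] [Module K V] {v : V}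
    (hv : v ≠ 0) (s : Projectivization K V) :
    (∃ c : K, v = c • s.rep) ↔ s = Projectivization.mk K v hv := by
  conv_rhs => rw [← s.mk_rep]
  rw [eq_comm, Projectivization.mk_eq_mk_iff' K v s.rep hv s.rep_nonzero]
  simp only [eq_comm]

/-- Double counting of incidences: each point of `α` is incident to all of `β` or to exactly
one element of it. -/
theorem natCard_incidences {α β : Type*} [Finite α] [Finite β] (I : β → α → Prop) (Z : α → Prop)
    (hZ : ∀ x, Z x → ∀ s, I s x) (hI : ∀ x, ¬ Z x → ∃! s, I s x) :
    (Nat.card α : ℤ) = Nat.card (Σ s : β, {x : α // I s x})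
      - ((Nat.card β : ℤ) - 1) * Nat.card {x : α // Z x} := by
  classical
  have := Fintype.ofFinite α
  have e : (Σ s : β, {x : α // I s x}) ≃ Σ x : α, {s : β // I s x} :=
    { toFun := fun t => ⟨t.2.1, t.1, t.2.2⟩
      invFun := fun t => ⟨t.2.1, t.1, t.2.2⟩
      left_inv := fun _ => rfl
      right_inv := fun _ => rfl }
  have h (x : α) : (Nat.card {s : β // I s x} : ℤ)
      = 1 + ((Nat.card β : ℤ) - 1) * if Z x then 1 else 0 := by
    split_ifs with hx
    · rw [Nat.card_congr (Equiv.subtypeUnivEquiv (hZ x hx))]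
      ring
    · obtain ⟨s, hs, hu⟩ := hI x hx
      have : Unique {s : β // I s x} := ⟨⟨⟨s, hs⟩⟩, fun t => Subtype.ext (hu t.1 t.2)⟩
      simp
  rw [Nat.card_congr e, Nat.card_sigma, Nat.cast_sum, Finset.sum_congr rfl fun x _ => h x,
    Finset.sum_add_distrib, ← Finset.mul_sum, Finset.sum_boole]
  simp [Fintype.card_subtype]

/-- Let `p` be an odd prime, `f` a positive definite integral ternary form, `ε ∈ {0,1,-1}`
and `n > 0` with `(n/p) = ε`.  For a projective point `s = [v]` let
`L_s = {x ∈ ℤ³ : x mod p ∈ F_p·v}` and `s_p(ε,f) = {[v] : (f(v)/p) = ε}`.  Then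
`r(n,f) = ∑_{s ∈ s_p(ε,f)} #{x ∈ L_s : f(x) = n} − (|s_p(ε,f)| − 1)·#{x ∈ pℤ³ : f(x) = n}`. -/
theorem stmt_3 (p : ℕ) [Fact p.Prime] (hp2 : p ≠ 2)
    (a : Fin 3 → Fin 3 → ℤ)
    (hpos : ∀ x : Fin 3 → ℤ, x ≠ 0 → 0 < tf a x)
    (ε : ℤ) (hε : ε = 0 ∨ ε = 1 ∨ ε = -1)
    (n : ℤ) (hn : 0 < n) (hleg : legendreSym p n = ε) :
    (Nat.card {x : Fin 3 → ℤ // tf a x = n} : ℤ)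
      = (Nat.card (Σ s : {s : Projectivization (ZMod p) (Fin 3 → ZMod p) //
              quadraticChar (ZMod p) (tfBar p a s.rep) = ε},
            {x : Fin 3 → ℤ //
              (∃ c : ZMod p, (fun i => ((x i : ZMod p))) = c • s.1.rep) ∧ tf a x = n}) : ℤ)
        - ((Nat.card {s : Projectivization (ZMod p) (Fin 3 → ZMod p) //
                quadraticChar (ZMod p) (tfBar p a s.rep) = ε} : ℤ) - 1)
          * (Nat.card {x : Fin 3 → ℤ // (∀ i, (p : ℤ) ∣ x i) ∧ tf a x = n} : ℤ) := by
  have := finite_setOf_tf_eq a hpos n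
  have : Finite (Projectivization (ZMod p) (Fin 3 → ZMod p)) := Quotient.finite _
  have key := natCard_incidences (α := {x : Fin 3 → ℤ // tf a x = n})
    (β := {s : Projectivization (ZMod p) (Fin 3 → ZMod p) //
      quadraticChar (ZMod p) (tfBar p a s.rep) = ε})
    (fun s x => ∃ c : ZMod p, (fun i => ((x.1 i : ZMod p))) = c • s.1.rep)
    (fun x => ∀ i, (p : ℤ) ∣ x.1 i) ?_ ?_
  · have e (Q : (Fin 3 → ℤ) → Prop) :
        {x : {x : Fin 3 → ℤ // tf a x = n} // Q x.1} ≃ {x : Fin 3 → ℤ // Q x ∧ tf a x = n} :=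
      (Equiv.subtypeSubtypeEquivSubtypeInter _ Q).trans
        (Equiv.subtypeEquivRight fun _ => and_comm)
    refine key.trans (congrArg₂ (· - ·) (congrArg Nat.cast ?_) (congrArg₂ (· * ·) rfl
      (congrArg Nat.cast (Nat.card_congr (e fun x => ∀ i, (p : ℤ) ∣ x i)))))
    refine Nat.card_congr (Equiv.sigmaCongrRight ?_)
    exact fun s => e fun x => ∃ c : ZMod p, (fun i => ((x i : ZMod p))) = c • s.1.rep
  · intro x hx s
    refine ⟨0, ?_⟩
    ext i
    simpa using (ZMod.intCast_zmod_eq_zero_iff_dvd (x.1 i) p).2 (hx i)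
  · intro x hx
    have hv : (fun i => (x.1 i : ZMod p)) ≠ 0 := fun h =>
      hx fun i => (ZMod.intCast_zmod_eq_zero_iff_dvd (x.1 i) p).1 (congrFun h i)
    obtain ⟨c, hc⟩ := (exists_eq_smul_rep_iff (K := ZMod p) hv _).2 rfl
    have hc0 : c ≠ 0 := by
      rintro rfl
      exact hv (by rw [hc, zero_smul])
    refine ⟨⟨Projectivization.mk (ZMod p) _ hv, ?_⟩, ⟨c, hc⟩, fun s hs =>
      Subtype.ext ((exists_eq_smul_rep_iff hv s.1).1 hs)⟩
    rw [← quadraticChar_tfBar_smul p a hc0, ← hc, tfBar_intCast, x.2]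
    exact hleg
end
end

section
/- Let p be a prime and let A and B be symmetric positive definite 3×3 rational matrices which are half-integral (integral diagonal entries and off-diagonal entries in (1/2)ℤ) and satisfy det(B) = p⁴·det(A). Then the following three cardinalities are equal: #{T ∈ M₃(ℤ) : TᵗAT = B and pT⁻¹ ∈ M₃(ℤ)}, #{S ∈ M₃(ℤ) : SᵗA⁻¹S = p²B⁻¹}, and #{Y ∈ M₃(ℤ) : YᵗBY = p²A}. (The first quantity counts the representations σ of the lattice with Gram matrix B by the lattice with Gram matrix A whose cokernel ℤ³/Tℤ³ is isomorphic to ℤ/pℤ ⊕ ℤ/pℤ.) -/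
open Matrix

noncomputable section

theorem intMap_injective : Function.Injective intMap :=
  Matrix.map_injective Int.cast_injective

theorem intMap_transpose (X : Matrix (Fin 3) (Fin 3) ℤ) : intMap Xᵀ = (intMap X)ᵀ := rfl

theorem intMap_adjugate (X : Matrix (Fin 3) (Fin 3) ℤ) :
    intMap X.adjugate = (intMap X).adjugate :=
  (Int.castRingHom ℚ).map_adjugate X

theorem intMap_smul (k : ℤ) (X : Matrix (Fin 3) (Fin 3) ℤ) :
    intMap (k • X) = (k : ℚ) • intMap X := by
  ext i j
  simp only [intMap, map_apply, Matrix.smul_apply, smul_eq_mul, Int.cast_mul]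

theorem PosDef3.det_ne_zero {A : Matrix (Fin 3) (Fin 3) ℚ} (hA : PosDef3 A) : A.det ≠ 0 := by
  intro h
  obtain ⟨v, hv, hv'⟩ := Matrix.exists_mulVec_eq_zero_iff.mpr h
  simpa [hv'] using hA.2 v hv

section Field

variable {n K : Type*} [Fintype n] [DecidableEq n] [Field K] {A B Y T : Matrix n n K} {c : K}

theorem det_ne_zero_of_transpose_mul_mul_eq_smul (hA : A.det ≠ 0) (hc : c ≠ 0)
    (h : Yᵀ * B * Y = c ^ 2 • A) : Y.det ≠ 0 := by
  intro hY
  have h' := congrArg Matrix.det h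
  rw [det_mul, hY, mul_zero, det_smul] at h'
  exact mul_ne_zero (pow_ne_zero _ (pow_ne_zero _ hc)) hA h'.symm

theorem mul_inv_mul_transpose_eq_smul_inv (hA : A.det ≠ 0) (hB : B.det ≠ 0) (hc : c ≠ 0)
    (h : Yᵀ * B * Y = c ^ 2 • A) : Y * A⁻¹ * Yᵀ = c ^ 2 • B⁻¹ := by
  have hY := (det_ne_zero_of_transpose_mul_mul_eq_smul hA hc h).isUnit
  have hYt : IsUnit Yᵀ.det := by rwa [det_transpose]
  have hA' : A⁻¹ = c ^ 2 • (Y⁻¹ * B⁻¹ * Yᵀ⁻¹) := by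
    refine inv_eq_left_inv ?_
    rw [smul_mul, ← Matrix.mul_smul, ← h]
    simp only [Matrix.mul_assoc]
    rw [nonsing_inv_mul_cancel_left _ _ hYt, nonsing_inv_mul_cancel_left _ _ hB.isUnit,
      nonsing_inv_mul _ hY]
  rw [hA', Matrix.mul_smul, smul_mul]
  simp only [Matrix.mul_assoc]
  rw [nonsing_inv_mul _ hYt, mul_nonsing_inv_cancel_left _ _ hY, Matrix.mul_one]

theorem transpose_mul_mul_eq_smul_iff (hA : A.det ≠ 0) (hB : B.det ≠ 0) (hc : c ≠ 0) :
    Yᵀ * B * Y = c ^ 2 • A ↔ Y * A⁻¹ * Yᵀ = c ^ 2 • B⁻¹ := by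
  refine ⟨mul_inv_mul_transpose_eq_smul_inv hA hB hc, fun h => ?_⟩
  have hA' : A⁻¹.det ≠ 0 := (isUnit_nonsing_inv_det A hA.isUnit).ne_zero
  have hB' : B⁻¹.det ≠ 0 := (isUnit_nonsing_inv_det B hB.isUnit).ne_zero
  simpa [nonsing_inv_nonsing_inv _ hA.isUnit, nonsing_inv_nonsing_inv _ hB.isUnit] using
    mul_inv_mul_transpose_eq_smul_inv (Y := Yᵀ) hB' hA' hc (by simpa using h)

theorem smul_inv_smul_inv (hc : c ≠ 0) (hY : Y.det ≠ 0) : c • (c • Y⁻¹)⁻¹ = Y := by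
  have h : (c • Y⁻¹)⁻¹ = c⁻¹ • Y := inv_eq_left_inv <| by
    rw [smul_mul, Matrix.mul_smul, smul_smul, inv_mul_cancel₀ hc, one_smul,
      mul_nonsing_inv _ hY.isUnit]
  rw [h, smul_smul, mul_inv_cancel₀ hc, one_smul]

theorem transpose_mul_mul_smul_inv (hT : T.det ≠ 0) (h : Tᵀ * A * T = B) :
    (c • T⁻¹)ᵀ * B * (c • T⁻¹) = c ^ 2 • A := by
  have hTt : Tᵀ⁻¹ * Tᵀ = 1 := nonsing_inv_mul _ (by rw [det_transpose]; exact hT.isUnit)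
  rw [transpose_smul, transpose_nonsing_inv, smul_mul, smul_mul, Matrix.mul_smul, smul_smul,
    ← sq, ← h]
  simp only [Matrix.mul_assoc]
  rw [mul_nonsing_inv _ hT.isUnit, Matrix.mul_one, ← Matrix.mul_assoc, hTt, Matrix.one_mul]

theorem smul_inv_transpose_mul_mul (hc : c ≠ 0) (hY : Y.det ≠ 0) (h : Yᵀ * B * Y = c ^ 2 • A) :
    (c • Y⁻¹)ᵀ * A * (c • Y⁻¹) = B := by
  have h' := transpose_mul_mul_smul_inv (c := c) hY h
  rw [Matrix.mul_smul _ (c ^ 2) A, smul_mul] at h'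
  exact smul_right_injective _ (pow_ne_zero 2 hc) h'

end Field

/-- If `Yᵀ B Y = p² A` with `det B = p⁴ det A`, then `det Y = ± p`, so `p Y⁻¹ = ± adj Y`
is integral. -/
theorem exists_intMap_eq_smul_inv {p : ℕ} (hp : (p : ℚ) ≠ 0) {A B : Matrix (Fin 3) (Fin 3) ℚ}
    (hA : A.det ≠ 0) (hdet : B.det = (p : ℚ) ^ 4 * A.det) {Y : Matrix (Fin 3) (Fin 3) ℤ}
    (h : (intMap Y)ᵀ * B * intMap Y = (p : ℚ) ^ 2 • A) :
    ∃ T : Matrix (Fin 3) (Fin 3) ℤ, intMap T = (p : ℚ) • (intMap Y)⁻¹ := by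
  have hsq : (intMap Y).det ^ 2 = (p : ℚ) ^ 2 := by
    have h' := congrArg Matrix.det h
    rw [det_mul, det_mul, det_transpose, det_smul, hdet, Fintype.card_fin] at h'
    refine mul_right_cancel₀ (mul_ne_zero (pow_ne_zero 4 hp) hA) ?_
    linear_combination h'
  rw [inv_def, Ring.inverse_eq_inv']
  rcases sq_eq_sq_iff_eq_or_eq_neg.mp hsq with hY | hY
  · refine ⟨Y.adjugate, ?_⟩
    rw [intMap_adjugate, hY, smul_smul, mul_inv_cancel₀ hp, one_smul]
  · refine ⟨(-1 : ℤ) • Y.adjugate, ?_⟩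
    rw [intMap_smul, intMap_adjugate, hY, smul_smul, inv_neg, mul_neg, mul_inv_cancel₀ hp]
    norm_num

/-- Let `p` be a prime and `A`, `B` half-integral symmetric positive definite `3×3` rational
matrices with `det B = p⁴ det A`.  Then the number of integral `T` with `Tᵀ A T = B` and
`p T⁻¹` integral, the number of integral `S` with `Sᵀ A⁻¹ S = p² B⁻¹`, and the number of
integral `Y` with `Yᵀ B Y = p² A` all coincide. -/
theorem stmt_4 (p : ℕ) (hp : p.Prime)
    (A B : Matrix (Fin 3) (Fin 3) ℚ) (hA : PosDef3 A) (hB : PosDef3 B)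
    (hAh : HalfIntegral A) (hBh : HalfIntegral B)
    (hdet : B.det = (p : ℚ) ^ 4 * A.det) :
    Nat.card {T : Matrix (Fin 3) (Fin 3) ℤ //
        (intMap T)ᵀ * A * intMap T = B ∧
        ∃ U : Matrix (Fin 3) (Fin 3) ℤ, (p : ℚ) • (intMap T)⁻¹ = intMap U}
      = Nat.card {S : Matrix (Fin 3) (Fin 3) ℤ //
          (intMap S)ᵀ * A⁻¹ * intMap S = (p : ℚ) ^ 2 • B⁻¹} ∧
    Nat.card {S : Matrix (Fin 3) (Fin 3) ℤ //
        (intMap S)ᵀ * A⁻¹ * intMap S = (p : ℚ) ^ 2 • B⁻¹}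
      = Nat.card {Y : Matrix (Fin 3) (Fin 3) ℤ //
          (intMap Y)ᵀ * B * intMap Y = (p : ℚ) ^ 2 • A} := by
  have hp0 : (p : ℚ) ≠ 0 := Nat.cast_ne_zero.mpr hp.ne_zero
  have hA0 := hA.det_ne_zero
  have hB0 := hB.det_ne_zero
  have hST : Nat.card {S : Matrix (Fin 3) (Fin 3) ℤ //
        (intMap S)ᵀ * A⁻¹ * intMap S = (p : ℚ) ^ 2 • B⁻¹}
      = Nat.card {Y : Matrix (Fin 3) (Fin 3) ℤ //
          (intMap Y)ᵀ * B * intMap Y = (p : ℚ) ^ 2 • A} := by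
    refine Nat.card_congr ((transposeAddEquiv (Fin 3) (Fin 3) ℤ).toEquiv.subtypeEquiv fun S => ?_)
    change _ ↔ (intMap Sᵀ)ᵀ * B * intMap Sᵀ = _
    rw [transpose_mul_mul_eq_smul_iff hA0 hB0 hp0, intMap_transpose, transpose_transpose]
  refine ⟨Eq.trans (Eq.symm ?_) hST.symm, hST⟩
  have hdetY {Y : Matrix (Fin 3) (Fin 3) ℤ}
      (h : (intMap Y)ᵀ * B * intMap Y = (p : ℚ) ^ 2 • A) : (intMap Y).det ≠ 0 :=
    det_ne_zero_of_transpose_mul_mul_eq_smul hA0 hp0 h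
  choose! f hf using fun Y : Matrix (Fin 3) (Fin 3) ℤ =>
    exists_intMap_eq_smul_inv (Y := Y) hp0 hA0 hdet
  refine Nat.card_congr (Equiv.ofBijective (fun Y => ⟨f Y.1, ?_, Y.1, ?_⟩) ⟨?_, ?_⟩)
  · rw [hf _ Y.2]
    exact smul_inv_transpose_mul_mul hp0 (hdetY Y.2) Y.2
  · rw [hf _ Y.2, smul_inv_smul_inv hp0 (hdetY Y.2)]
  · rintro ⟨Y, hY⟩ ⟨Z, hZ⟩ hYZ
    have h : f Y = f Z := congrArg Subtype.val hYZ
    refine Subtype.ext (intMap_injective ?_)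
    change intMap Y = intMap Z
    rw [← smul_inv_smul_inv hp0 (hdetY hY), ← smul_inv_smul_inv hp0 (hdetY hZ), ← hf _ hY,
      ← hf _ hZ, h]
  · rintro ⟨T, hT, U, hU⟩
    have hT0 : (intMap T).det ≠ 0 := by
      intro h
      rw [← hT, det_mul, h, mul_zero] at hB0
      exact hB0 rfl
    have hUB : (intMap U)ᵀ * B * intMap U = (p : ℚ) ^ 2 • A := by
      rw [← hU]
      exact transpose_mul_mul_smul_inv hT0 hT
    refine ⟨⟨U, hUB⟩, Subtype.ext (intMap_injective ?_)⟩
    change intMap (f U) = intMap T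
    rw [hf _ hUB, ← hU, smul_inv_smul_inv hp0 hT0]
end
end

section
/- Let p be an odd prime and let A be a half-integral symmetric positive definite 3×3 rational matrix with p ∤ 4·det(A). Suppose X ∈ M₃(ℤ) is such that the matrix C := XᵗAX satisfies det(C) = p⁴·det(A), all diagonal entries of C lie in pℤ, and all off-diagonal entries of C lie in (p/2)ℤ (equivalently: the quadratic form x ↦ xᵗCx takes all its values on ℤ³ in pℤ). Then ℤ³/Xℤ³ ≅ ℤ/pℤ ⊕ ℤ/pℤ; in particular pX⁻¹ ∈ M₃(ℤ), and the quotient ℤ³/Xℤ³ is never cyclic of order p². -/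
open Matrix

noncomputable section

/-- A `3 × 3` matrix of rank at most one has vanishing adjugate. -/
theorem adjugate_eq_zero_of_rank_le_one {K : Type*} [Field K] {Y : Matrix (Fin 3) (Fin 3) K}
    (hY : Y.rank ≤ 1) : Y.adjugate = 0 := by
  obtain ⟨v, hv⟩ := finrank_le_one_iff.mp hY
  have hcol (j : Fin 3) : ∃ c : K, ∀ i, Y i j = c * v.1 i := by
    obtain ⟨c, hc⟩ := hv ⟨Y.mulVecLin (Pi.single j 1), LinearMap.mem_range_self _ _⟩
    refine ⟨c, fun i => ?_⟩
    simpa using (congrFun (congrArg Subtype.val hc) i).symm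
  choose c hc using hcol
  rw [adjugate_fin_three]
  ext i j
  fin_cases i <;> fin_cases j <;> simp [hc] <;> ring

/-- A matrix whose columns span a totally isotropic subspace for a nondegenerate ternary
bilinear form has rank at most one. -/
theorem rank_le_one_of_transpose_mul_mul_eq_zero {K : Type*} [Field K]
    {B Y : Matrix (Fin 3) (Fin 3) K} (hB : B.det ≠ 0) (h : Yᵀ * B * Y = 0) : Y.rank ≤ 1 := by
  have h1 := rank_add_rank_le_card_of_mul_eq_zero h
  rw [rank_mul_eq_left_of_det_ne_zero _ _ hB, rank_transpose, Fintype.card_fin] at h1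
  omega

/-- If `Yᵀ B Y` vanishes modulo a prime not dividing `det B`, then that prime divides all
`2 × 2` minors of `Y`. -/
theorem exists_adjugate_eq_smul {p : ℕ} [Fact p.Prime] {B Y K : Matrix (Fin 3) (Fin 3) ℤ}
    (hB : ¬ (p : ℤ) ∣ B.det) (h : Yᵀ * B * Y = (p : ℤ) • K) :
    ∃ M : Matrix (Fin 3) (Fin 3) ℤ, Y.adjugate = (p : ℤ) • M := by
  let f := Int.castRingHom (ZMod p)
  have hB' : (f.mapMatrix B).det ≠ 0 := by
    rw [← RingHom.map_det]
    exact fun h0 => hB ((ZMod.intCast_zmod_eq_zero_iff_dvd _ _).mp h0)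
  have h' : (f.mapMatrix Y)ᵀ * f.mapMatrix B * f.mapMatrix Y = 0 := by
    have h2 := congrArg f.mapMatrix h
    rw [map_mul, map_mul] at h2
    refine h2.trans ?_
    ext i j
    change (((p : ℤ) * K i j : ℤ) : ZMod p) = 0
    simp
  have hadj := adjugate_eq_zero_of_rank_le_one (rank_le_one_of_transpose_mul_mul_eq_zero hB' h')
  rw [← RingHom.map_adjugate] at hadj
  have hdvd (i j : Fin 3) : (p : ℤ) ∣ Y.adjugate i j :=
    (ZMod.intCast_zmod_eq_zero_iff_dvd _ _).mp (congrFun (congrFun hadj i) j)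
  choose M hM using hdvd
  exact ⟨Matrix.of M, by ext i j; simpa using hM i j⟩

/-- The cokernel of a nonsingular integral matrix has order the absolute value of its
determinant. -/
theorem card_quotient_range_mulVecLin {n : Type*} [Fintype n] [DecidableEq n]
    {Y : Matrix n n ℤ} (hY : Y.det ≠ 0) :
    Nat.card ((n → ℤ) ⧸ LinearMap.range Y.mulVecLin) = Y.det.natAbs := by
  have hinj : Function.Injective Y.mulVecLin := mulVec_injective_of_det_ne_zero hY
  rw [← Submodule.natAbs_det_equiv _ (LinearEquiv.ofInjective Y.mulVecLin hinj),
    ← LinearMap.det_toLin' Y]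
  rfl

/-- A vector space of cardinality `p ^ 2` over `ℤ/p` is isomorphic to `ℤ/p ⊕ ℤ/p`. -/
theorem nonempty_linearEquiv_zmod_prod {p : ℕ} [Fact p.Prime] {V : Type*} [AddCommGroup V]
    [Module (ZMod p) V] (hcard : Nat.card V = p ^ 2) :
    Nonempty (V ≃ₗ[ZMod p] (ZMod p × ZMod p)) := by
  have hp : p.Prime := Fact.out
  have : Finite V := Nat.finite_of_card_ne_zero (by rw [hcard]; exact pow_ne_zero _ hp.ne_zero)
  have h := Module.natCard_eq_pow_finrank (K := ZMod p) (V := V)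
  rw [hcard, Nat.card_zmod] at h
  have h2 : Module.finrank (ZMod p) V = 2 := (Nat.pow_right_injective hp.two_le h).symm
  exact ⟨LinearEquiv.ofFinrankEq _ _ (by simp [h2])⟩

/-- An abelian group of order `p ^ 2` and exponent `p` is isomorphic to `ℤ/p ⊕ ℤ/p`. -/
theorem nonempty_addEquiv_zmod_prod {p : ℕ} [Fact p.Prime] {Q : Type*} [AddCommGroup Q]
    (hcard : Nat.card Q = p ^ 2) (hexp : ∀ x : Q, p • x = 0) :
    Nonempty (Q ≃+ (ZMod p × ZMod p)) :=
  let _ : Module (ZMod p) Q := AddCommGroup.zmodModule hexp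
  (nonempty_linearEquiv_zmod_prod hcard).map LinearEquiv.toAddEquiv

/-- An abelian group of exponent `p` is not cyclic of order `p ^ 2`. -/
theorem not_nonempty_addEquiv_zmod_sq {p : ℕ} [Fact p.Prime] {Q : Type*} [AddCommGroup Q]
    (hexp : ∀ x : Q, p • x = 0) : ¬ Nonempty (Q ≃+ ZMod (p ^ 2)) := by
  rintro ⟨e⟩
  have hp : 1 < p := (Fact.out : p.Prime).one_lt
  have h1 : ((p : ℕ) : ZMod (p ^ 2)) = 0 := by
    have h2 := congrArg e (hexp (e.symm 1))
    simpa using h2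
  rw [ZMod.natCast_eq_zero_iff] at h1
  have := Nat.le_of_dvd (by omega) h1
  nlinarith

/-- Let `p` be an odd prime and `A` a half-integral symmetric positive definite matrix with
`p ∤ 4 det A`.  If `X` is integral and `C = Xᵀ A X` satisfies `det C = p⁴ det A`, has diagonal
entries in `pℤ` and off-diagonal entries in `(p/2)ℤ`, then `ℤ³/Xℤ³ ≅ ℤ/p ⊕ ℤ/p`; in
particular `p X⁻¹` is integral and the quotient is never cyclic of order `p²`. -/
theorem stmt_5 (p : ℕ) [Fact p.Prime] (hp2 : p ≠ 2)
    (A : Matrix (Fin 3) (Fin 3) ℚ) (hA : PosDef3 A) (hAh : HalfIntegral A)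
    (D : ℤ) (hD : 4 * A.det = (D : ℚ)) (hpD : ¬ (p : ℤ) ∣ D)
    (X : Matrix (Fin 3) (Fin 3) ℤ)
    (C : Matrix (Fin 3) (Fin 3) ℚ) (hC : C = (intMap X)ᵀ * A * intMap X)
    (hCdet : C.det = (p : ℚ) ^ 4 * A.det)
    (hdiag : ∀ i, ∃ k : ℤ, C i i = (p : ℚ) * k)
    (hoff : ∀ i j, i ≠ j → ∃ k : ℤ, 2 * C i j = (p : ℚ) * k) :
    Nonempty (((Fin 3 → ℤ) ⧸ LinearMap.range (Matrix.mulVecLin X)) ≃+ (ZMod p × ZMod p)) ∧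
    (∃ U : Matrix (Fin 3) (Fin 3) ℤ,
      X * U = (p : ℤ) • (1 : Matrix (Fin 3) (Fin 3) ℤ) ∧
      U * X = (p : ℤ) • (1 : Matrix (Fin 3) (Fin 3) ℤ)) ∧
    ¬ Nonempty (((Fin 3 → ℤ) ⧸ LinearMap.range (Matrix.mulVecLin X)) ≃+ ZMod (p ^ 2)) := by
  have hp : p.Prime := Fact.out
  have hp0 : (p : ℤ) ≠ 0 := by exact_mod_cast hp.ne_zero
  choose B hB using hAh.2
  have hBA : intMap (Matrix.of B) = (2 : ℚ) • A := by
    ext i j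
    simp [intMap, hB]
  have hBdet : (Matrix.of B).det = 2 * D := by
    have h1 : (((Matrix.of B).det : ℤ) : ℚ) = (intMap (Matrix.of B)).det :=
      (Int.castRingHom ℚ).map_det _
    rw [hBA, det_smul, Fintype.card_fin] at h1
    have h2 : (((Matrix.of B).det : ℤ) : ℚ) = ((2 * D : ℤ) : ℚ) := by
      rw [h1, Int.cast_mul, ← hD]
      push_cast
      ring
    exact_mod_cast h2
  have hpB : ¬ (p : ℤ) ∣ (Matrix.of B).det := by
    rw [hBdet]
    intro h
    rcases (Nat.prime_iff_prime_int.mp hp).dvd_or_dvd h with h | h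
    · exact hp2 ((Nat.prime_dvd_prime_iff_eq hp Nat.prime_two).mp (by exact_mod_cast h))
    · exact hpD h
  have hC2 (i j : Fin 3) : ∃ k : ℤ, 2 * C i j = (p : ℚ) * k := by
    by_cases hij : i = j
    · subst hij
      obtain ⟨k, hk⟩ := hdiag i
      exact ⟨2 * k, by rw [hk]; push_cast; ring⟩
    · exact hoff i j hij
  choose K hK using hC2
  have hXBX : Xᵀ * Matrix.of B * X = (p : ℤ) • Matrix.of K := by
    have h1 : intMap (Xᵀ * Matrix.of B * X) = (2 : ℚ) • C := by
      have h2 : intMap (Xᵀ * Matrix.of B * X) = (intMap X)ᵀ * intMap (Matrix.of B) * intMap X := by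
        refine (map_mul (Int.castRingHom ℚ).mapMatrix (Xᵀ * Matrix.of B) X).trans ?_
        rw [map_mul]
        rfl
      rw [h2, hBA, hC]
      simp
    ext i j
    have h3 := congrFun (congrFun h1 i) j
    rw [Matrix.smul_apply, smul_eq_mul, hK] at h3
    simp only [Matrix.smul_apply, smul_eq_mul, Matrix.of_apply]
    simp only [intMap, Matrix.map_apply] at h3
    exact_mod_cast h3
  obtain ⟨M, hM⟩ := exists_adjugate_eq_smul hpB hXBX
  have hAdet : A.det ≠ 0 := by
    intro h
    rw [h, mul_zero] at hD
    have : D = 0 := by exact_mod_cast hD.symm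
    exact hpD (this ▸ dvd_zero _)
  have hXdet : X.det = (p : ℤ) ^ 2 ∨ X.det = -(p : ℤ) ^ 2 := by
    have h1 : ((X.det : ℤ) : ℚ) = (intMap X).det := (Int.castRingHom ℚ).map_det _
    rw [hC, det_mul, det_mul, det_transpose, ← h1] at hCdet
    have h2 : ((X.det : ℤ) : ℚ) ^ 2 = ((p : ℚ) ^ 2) ^ 2 :=
      mul_right_cancel₀ hAdet (by linear_combination hCdet)
    exact sq_eq_sq_iff_eq_or_eq_neg.mp (by exact_mod_cast h2)
  obtain ⟨ε, hε, hεX⟩ : ∃ ε : ℤ, ε * ε = 1 ∧ X.det = p * (ε * p) := by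
    rcases hXdet with h | h
    · exact ⟨1, by norm_num, by rw [h]; ring⟩
    · exact ⟨-1, by norm_num, by rw [h]; ring⟩
  have hXM : X * M = (ε * p) • (1 : Matrix (Fin 3) (Fin 3) ℤ) := by
    have h1 := mul_adjugate X
    rw [hM, Matrix.mul_smul, hεX, mul_smul] at h1
    exact smul_right_injective _ hp0 h1
  have hMX : M * X = (ε * p) • (1 : Matrix (Fin 3) (Fin 3) ℤ) := by
    have h1 := adjugate_mul X
    rw [hM, Matrix.smul_mul, hεX, mul_smul] at h1
    exact smul_right_injective _ hp0 h1
  have hXU : X * (ε • M) = (p : ℤ) • (1 : Matrix (Fin 3) (Fin 3) ℤ) := by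
    rw [Matrix.mul_smul, hXM, smul_smul, ← mul_assoc, hε, one_mul]
  have hUX : (ε • M) * X = (p : ℤ) • (1 : Matrix (Fin 3) (Fin 3) ℤ) := by
    rw [Matrix.smul_mul, hMX, smul_smul, ← mul_assoc, hε, one_mul]
  have hcard : Nat.card ((Fin 3 → ℤ) ⧸ LinearMap.range (Matrix.mulVecLin X)) = p ^ 2 := by
    rw [card_quotient_range_mulVecLin]
    · rcases hXdet with h | h <;> simp [h, Int.natAbs_pow]
    · rcases hXdet with h | h <;> simp [h, hp.ne_zero]
  have hexp (x : (Fin 3 → ℤ) ⧸ LinearMap.range (Matrix.mulVecLin X)) : p • x = 0 := by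
    induction x using Submodule.Quotient.induction_on with
    | _ y =>
      rw [← Submodule.Quotient.mk_smul, Submodule.Quotient.mk_eq_zero]
      refine ⟨(ε • M) *ᵥ y, ?_⟩
      rw [mulVecLin_apply, mulVec_mulVec, hXU, smul_mulVec, one_mulVec, natCast_zsmul]
  exact ⟨nonempty_addEquiv_zmod_prod hcard hexp, ⟨ε • M, hXU, hUX⟩,
    not_nonempty_addEquiv_zmod_sq hexp⟩
end
end

section
/- Let p be a prime and let f(x₁,x₂,x₃) = Σ_{1≤i≤j≤3} a_{ij}x_i x_j be a positive definite integral ternary quadratic form such that p ∤ a₁₂ and p divides a₁₁, a₂₂, a₃₃, a₁₃ and a₂₃. Then there are exactly two subgroups M of ℤ³ of index p on which f takes all its values in pℤ, namely M₁ = {x ∈ ℤ³ : p | x₁} and M₂ = {x ∈ ℤ³ : p | x₂}. -/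
noncomputable section

/-- The subgroup of integer vectors whose `i`-th coordinate is divisible by `p`. -/
def coordMod {ι : Type*} (p : ℕ) (i : ι) : AddSubgroup (ι → ℤ) :=
  ((Int.castAddHom (ZMod p)).comp (Pi.evalAddMonoidHom (fun _ : ι => ℤ) i)).ker

theorem mem_coordMod {ι : Type*} {p : ℕ} {i : ι} {x : ι → ℤ} :
    x ∈ coordMod p i ↔ (p : ℤ) ∣ x i := by
  simp [coordMod, AddMonoidHom.mem_ker, ZMod.intCast_zmod_eq_zero_iff_dvd]

theorem index_coordMod {ι : Type*} (p : ℕ) (i : ι) : (coordMod p i).index = p := by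
  have hsurj : Function.Surjective
      ((Int.castAddHom (ZMod p)).comp (Pi.evalAddMonoidHom (fun _ : ι => ℤ) i)) := fun y => by
    obtain ⟨n, rfl⟩ := ZMod.intCast_surjective y
    exact ⟨fun _ => n, rfl⟩
  rw [coordMod, AddSubgroup.index_ker, AddMonoidHom.range_eq_top.mpr hsurj]
  simp

/-- A subgroup contained in the union of two subgroups is contained in one of them. -/
theorem AddSubgroup.le_or_le_of_forall_mem_or {G : Type*} [AddGroup G] {M H K : AddSubgroup G}
    (h : ∀ x ∈ M, x ∈ H ∨ x ∈ K) : M ≤ H ∨ M ≤ K := by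
  by_contra! hc
  obtain ⟨x, hxM, hxH⟩ := SetLike.not_le_iff_exists.mp hc.1
  obtain ⟨y, hyM, hyK⟩ := SetLike.not_le_iff_exists.mp hc.2
  have hxK : x ∈ K := (h x hxM).resolve_left hxH
  have hyH : y ∈ H := (h y hyM).resolve_right hyK
  rcases h (x + y) (M.add_mem hxM hyM) with hs | hs
  · exact hxH ((H.add_mem_cancel_right hyH).mp hs)
  · exact hyK ((K.add_mem_cancel_left hxK).mp hs)

theorem AddSubgroup.eq_of_le_of_index_eq {G : Type*} [AddGroup G] {H K : AddSubgroup G}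
    (hle : H ≤ K) (hindex : H.index = K.index) (hK : K.index ≠ 0) : H = K := by
  refine le_antisymm hle (AddSubgroup.relIndex_eq_one.mp ?_)
  have hmul := AddSubgroup.relIndex_mul_index hle
  rw [hindex] at hmul
  exact (Nat.mul_eq_right hK).mp hmul

theorem dvd_tf_iff {p : ℕ} (hp : p.Prime) {a : Fin 3 → Fin 3 → ℤ}
    (h12 : ¬ (p : ℤ) ∣ a 0 1)
    (h11 : (p : ℤ) ∣ a 0 0) (h22 : (p : ℤ) ∣ a 1 1) (h33 : (p : ℤ) ∣ a 2 2)
    (h13 : (p : ℤ) ∣ a 0 2) (h23 : (p : ℤ) ∣ a 1 2) (x : Fin 3 → ℤ) :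
    (p : ℤ) ∣ tf a x ↔ (p : ℤ) ∣ x 0 ∨ (p : ℤ) ∣ x 1 := by
  have hp' : Prime (p : ℤ) := Nat.prime_iff_prime_int.mp hp
  have hsplit : tf a x = (a 0 0 * (x 0 * x 0) + a 1 1 * (x 1 * x 1) + a 2 2 * (x 2 * x 2)
      + a 0 2 * (x 0 * x 2) + a 1 2 * (x 1 * x 2)) + a 0 1 * (x 0 * x 1) := by
    simp [tf, Fin.sum_univ_three]
    ring
  rw [hsplit, dvd_add_right, hp'.dvd_mul, hp'.dvd_mul, or_iff_right h12]
  exact dvd_add (dvd_add (dvd_add (dvd_add (h11.mul_right _) (h22.mul_right _))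
    (h33.mul_right _)) (h13.mul_right _)) (h23.mul_right _)

/-- Let `p` be a prime and `f = ∑_{i≤j} a_{ij} x_i x_j` positive definite with `p ∤ a₁₂` and
`p ∣ a₁₁, a₂₂, a₃₃, a₁₃, a₂₃`.  Then the subgroups of `ℤ³` of index `p` on which
`f` takes all its values in `pℤ` are exactly `M₁ = {x : p ∣ x₁}` and `M₂ = {x : p ∣ x₂}`. -/
theorem stmt_7 (p : ℕ) (hp : p.Prime)
    (a : Fin 3 → Fin 3 → ℤ)
    (hpos : ∀ x : Fin 3 → ℤ, x ≠ 0 → 0 < tf a x)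
    (h12 : ¬ (p : ℤ) ∣ a 0 1)
    (h11 : (p : ℤ) ∣ a 0 0) (h22 : (p : ℤ) ∣ a 1 1) (h33 : (p : ℤ) ∣ a 2 2)
    (h13 : (p : ℤ) ∣ a 0 2) (h23 : (p : ℤ) ∣ a 1 2) :
    ∀ M : AddSubgroup (Fin 3 → ℤ),
      (M.index = p ∧ ∀ x ∈ M, (p : ℤ) ∣ tf a x) ↔
        ((∀ x, x ∈ M ↔ (p : ℤ) ∣ x 0) ∨ (∀ x, x ∈ M ↔ (p : ℤ) ∣ x 1)) := by
  intro M
  simp only [dvd_tf_iff hp h12 h11 h22 h33 h13 h23, ← mem_coordMod (p := p),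
    ← SetLike.ext_iff]
  constructor
  · rintro ⟨hindex, hM⟩
    have hlift (i : Fin 3) (hle : M ≤ coordMod p i) : M = coordMod p i :=
      AddSubgroup.eq_of_le_of_index_eq hle (hindex.trans (index_coordMod p i).symm)
        (by rw [index_coordMod]; exact hp.ne_zero)
    exact (AddSubgroup.le_or_le_of_forall_mem_or hM).imp (hlift 0) (hlift 1)
  · rintro (rfl | rfl)
    · exact ⟨index_coordMod p 0, fun _ => Or.inl⟩
    · exact ⟨index_coordMod p 1, fun _ => Or.inr⟩
end
end
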